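/- Define the obstacle ψ : ℝ² → ℝ by ψ(x) = (A_Γ − |x|²)/2 for x ∈ Γ and ψ(x) = (A_0 − |x|²)/2 for x ∉ Γ. Then U^{μ_a} belongs to H¹_loc(ℝ²), and for every continuous function v : ℝ² → ℝ belonging to H¹_loc(ℝ²) such that v − U^{μ_a} has compact support and v(x) ≥ ψ(x) for all x ∈ ℝ², one has ∫_{ℝ²} ∇U^{μ_a} · ∇(v − U^{μ_a}) dx ≥ 0 (the integrand vanishes outside a compact set, so the integral is well defined). -/

import Mathlib

open MeasureTheory Real
open scoped ENNReal

abbrev Plane : Type := EuclideanSpace ℝ (Fin 2)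

noncomputable def logKernel (x y : Plane) : ℝ := Real.log (1 / dist x y)

/- For a probability measure `μ`, `wEnergy μ` equals `I[μ] + 1` where
`I[μ] = ∫∫ log(1/|x-y|) dμdμ + ∫ |x|² dμ ∈ (-∞, +∞]`
(the kernel takes the value `+∞` on the diagonal). -/
open Classical in
noncomputable def wKernel (x y : Plane) : ℝ≥0∞ :=
  if x = y then ⊤ else ENNReal.ofReal (logKernel x y + (‖x‖ ^ 2 + ‖y‖ ^ 2) / 2 + 1)

noncomputable def wEnergy (μ : Measure Plane) : ℝ≥0∞ :=
  ∫⁻ p : Plane × Plane, wKernel p.1 p.2 ∂(μ.prod μ)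

def Ma (Γ : Set Plane) (a : ℝ) : Set (Measure Plane) :=
  {μ | IsProbabilityMeasure μ ∧ ENNReal.ofReal a ≤ μ Γ}

def IsMinimizer (Γ : Set Plane) (a : ℝ) (μa : Measure Plane) : Prop :=
  μa ∈ Ma Γ a ∧ wEnergy μa < ⊤ ∧ ∀ μ ∈ Ma Γ a, wEnergy μa ≤ wEnergy μ

structure RegularCurve (γ : ℝ → Plane) (Γ : Set Plane) : Prop where
  injective : Function.Injective γ
  image : Γ = Set.range γ
  closed : IsClosed Γ
  contDiff : ContDiff ℝ 1 γ
  unitSpeed : ∀ t, ‖deriv γ t‖ = 1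
  holder : ∃ α : ℝ, α ∈ Set.Ioc (0:ℝ) 1 ∧ ∃ M : ℝ, 0 ≤ M ∧
    ∀ s t : ℝ, ‖deriv γ t - deriv γ s‖ ≤ M * |t - s| ^ α


open scoped RealInnerProductSpace

/-- The logarithmic potential `U^μ(x) = ∫ log(1/|x-y|) dμ(y)`. -/
noncomputable def logPot (μ : Measure Plane) (x : Plane) : ℝ := ∫ y, logKernel x y ∂μ

/-- `A_Γ = (1/a) ∫_Γ (2U^{μ_a}(x) + |x|²) dμ_a(x)`. -/
noncomputable def AΓ (Γ : Set Plane) (a : ℝ) (μa : Measure Plane) : ℝ :=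
  a⁻¹ * ∫ x in Γ, (2 * logPot μa x + ‖x‖ ^ 2) ∂μa

/-- `A_0 = (1/(1-a)) ∫_{ℝ²∖Γ} (2U^{μ_a}(x) + |x|²) dμ_a(x)`. -/
noncomputable def A0 (Γ : Set Plane) (a : ℝ) (μa : Measure Plane) : ℝ :=
  (1 - a)⁻¹ * ∫ x in Γᶜ, (2 * logPot μa x + ‖x‖ ^ 2) ∂μa

/- The obstacle `ψ(x) = (A_Γ - |x|²)/2` on `Γ` and `ψ(x) = (A_0 - |x|²)/2`
off `Γ`. -/
open Classical in
noncomputable def obstacle (Γ : Set Plane) (a : ℝ) (μa : Measure Plane)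
    (x : Plane) : ℝ :=
  if x ∈ Γ then (AΓ Γ a μa - ‖x‖ ^ 2) / 2 else (A0 Γ a μa - ‖x‖ ^ 2) / 2

/-- `w` is the distributional (weak) gradient of `u` on `ℝ²`: both are locally
integrable and `∫ u ∂_v φ = -∫ φ ⟨w, v⟩` for all test functions `φ` and all
directions `v`. -/
def HasWeakGradient (u : Plane → ℝ) (w : Plane → Plane) : Prop :=
  LocallyIntegrable u volume ∧ LocallyIntegrable w volume ∧
  ∀ φ : Plane → ℝ, ContDiff ℝ (⊤ : ℕ∞) φ → HasCompactSupport φ → ∀ v : Plane,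
    ∫ x, u x * fderiv ℝ φ x v ∂volume = - ∫ x, φ x * ⟪w x, v⟫ ∂volume

/-- `f` is locally square integrable. -/
def LocSqInt {E : Type*} [NormedAddCommGroup E] (f : Plane → E) : Prop :=
  ∀ K : Set Plane, IsCompact K → (∫⁻ x in K, (‖f x‖₊ : ℝ≥0∞) ^ 2 ∂volume) < ⊤

open Filter Topology Metric

theorem integral_fun_norm_plane (f : ℝ → ℝ) :
    ∫ x : Plane, f ‖x‖ = 2 * π * ∫ y in Set.Ioi (0 : ℝ), y * f y := by
  have h := integral_fun_norm_addHaar (volume : Measure Plane) f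
  have hv : (volume : Measure Plane).real (ball 0 1) = π := by
    simp [Measure.real, Real.pi_pos.le]
  rw [h, hv]
  simp [finrank_euclideanSpace]
  ring

theorem integrableOn_ball_inv_norm_mul {d : ℝ} (hd : 0 < d) :
    IntegrableOn (fun x : Plane => ‖x‖⁻¹ * (‖x‖ + d)⁻¹) (ball 0 1) := by
  rw [integrableOn_fun_norm_addHaar (volume : Measure Plane)
    (f := fun r => r⁻¹ * (r + d)⁻¹)]
  have hc : IntegrableOn (fun r : ℝ => (r + d)⁻¹) (Set.Ioo 0 1) := by
    refine IntegrableOn.mono_set (ContinuousOn.integrableOn_compact isCompact_Icc ?_)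
      Set.Ioo_subset_Icc_self
    exact ContinuousOn.inv₀ (by fun_prop) fun x hx => by have := hx.1; positivity
  refine hc.congr_fun (fun r hr => ?_) measurableSet_Ioo
  have := hr.1
  simp [finrank_euclideanSpace, this.ne']

theorem setIntegral_ball_inv_norm_mul {d : ℝ} (hd : 0 < d) :
    ∫ x : Plane in ball 0 1, ‖x‖⁻¹ * (‖x‖ + d)⁻¹ = 2 * π * (log (1 + d) - log d) := by
  have h1 : ∫ x : Plane in ball 0 1, ‖x‖⁻¹ * (‖x‖ + d)⁻¹
      = ∫ x : Plane, (Set.Iio 1).indicator (fun r : ℝ => r⁻¹ * (r + d)⁻¹) ‖x‖ := by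
    rw [← integral_indicator measurableSet_ball]
    congr 1
    ext x
    simp [Set.indicator]
  have h2 : ∫ y in Set.Ioi (0 : ℝ), y * (Set.Iio 1).indicator (fun r : ℝ => r⁻¹ * (r + d)⁻¹) y
      = ∫ y in Set.Ioo (0 : ℝ) 1, (y + d)⁻¹ := by
    rw [← Set.Ioi_inter_Iio, ← setIntegral_indicator measurableSet_Iio]
    refine setIntegral_congr_fun measurableSet_Ioi fun y hy => ?_
    have : y ≠ 0 := (Set.mem_Ioi.1 hy).ne'
    by_cases h : y < 1 <;> simp [h, this]
  rw [h1, integral_fun_norm_plane, h2, ← integral_Ioc_eq_integral_Ioo,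
    ← intervalIntegral.integral_of_le zero_le_one]
  congr 1
  have : ∀ x ∈ Set.uIcc (0 : ℝ) 1, HasDerivAt (fun y => log (y + d)) ((x + d)⁻¹) x := by
    intro x hx
    rw [Set.uIcc_of_le zero_le_one] at hx
    have : x + d ≠ 0 := by have := hx.1; positivity
    simpa using ((hasDerivAt_id x).add_const d).log this
  rw [intervalIntegral.integral_eq_sub_of_hasDerivAt this]
  · simp
  · refine ContinuousOn.intervalIntegrable (ContinuousOn.inv₀ (by fun_prop) fun x hx => ?_)
    rw [Set.uIcc_of_le zero_le_one] at hx
    have := hx.1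
    positivity

theorem lintegral_ball_inv_norm_mul {d : ℝ} (hd : 0 < d) :
    ∫⁻ x : Plane in ball 0 1, ENNReal.ofReal (‖x‖⁻¹ * (‖x‖ + d)⁻¹)
      = ENNReal.ofReal (2 * π * (log (1 + d) - log d)) := by
  rw [← setIntegral_ball_inv_norm_mul hd,
    ofReal_integral_eq_lintegral_ofReal (integrableOn_ball_inv_norm_mul hd)]
  exact ae_of_all _ fun x => by positivity

theorem lintegral_ball_inv_dist_mul_le {d : ℝ} (hd : 0 < d) (R : ℝ) (y : Plane) :
    ∫⁻ x in ball 0 R, ENNReal.ofReal (‖x - y‖⁻¹ * (‖x - y‖ + d)⁻¹)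
      ≤ ENNReal.ofReal (2 * π * (log (1 + d) - log d)) + volume (ball (0 : Plane) R) := by
  set F : Plane → ℝ≥0∞ := fun x => ENNReal.ofReal (‖x‖⁻¹ * (‖x‖ + d)⁻¹)
  have hF : ∀ x, x ∉ ball (0 : Plane) 1 → F x ≤ 1 := by
    intro x hx
    have h1 : 1 ≤ ‖x‖ := by simpa using hx
    rw [← ENNReal.ofReal_one]
    refine ENNReal.ofReal_le_ofReal ?_
    exact mul_le_one₀ (inv_le_one_of_one_le₀ h1) (by positivity)
      (inv_le_one_of_one_le₀ (by linarith))
  calc ∫⁻ x in ball 0 R, F (x - y)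
      ≤ ∫⁻ x in ball 0 R, ((ball (0 : Plane) 1).indicator F (x - y) + 1) := by
        refine lintegral_mono fun x => ?_
        by_cases h : x - y ∈ ball (0 : Plane) 1
        · rw [Set.indicator_of_mem h]; exact le_self_add
        · exact (hF _ h).trans le_add_self
    _ = (∫⁻ x in ball 0 R, (ball (0 : Plane) 1).indicator F (x - y))
        + volume (ball (0 : Plane) R) := by
        rw [lintegral_add_right _ measurable_const]; simp
    _ ≤ (∫⁻ x, (ball (0 : Plane) 1).indicator F (x - y)) + volume (ball (0 : Plane) R) := by
        gcongr; exact Measure.restrict_le_self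
    _ = _ := by
        rw [lintegral_sub_right_eq_self, lintegral_indicator measurableSet_ball,
          lintegral_ball_inv_norm_mul hd]

theorem inv_mul_inv_le_of_le {p q d : ℝ} (hp : 0 < p) (hd : 0 < d) (hpq : p ≤ q)
    (h : d ≤ p + q) : p⁻¹ * q⁻¹ ≤ 3 * (p⁻¹ * (p + d)⁻¹) := by
  have hq : 0 < q := hp.trans_le hpq
  have : q⁻¹ ≤ 3 * (p + d)⁻¹ := by
    rw [← div_eq_mul_inv, le_div_iff₀ (by positivity), inv_mul_le_iff₀ hq]
    linarith
  calc p⁻¹ * q⁻¹ ≤ p⁻¹ * (3 * (p + d)⁻¹) := by gcongr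
    _ = _ := by ring

theorem lintegral_ball_inv_dist_mul_inv_dist_le {y z : Plane} (hyz : y ≠ z) (R : ℝ) :
    ∫⁻ x in ball 0 R, ‖x - y‖ₑ⁻¹ * ‖x - z‖ₑ⁻¹
      ≤ 6 * (ENNReal.ofReal (2 * π * (‖y - z‖ + |log ‖y - z‖|))
        + volume (ball (0 : Plane) R)) := by
  set d := ‖y - z‖
  have hd : 0 < d := norm_pos_iff.2 (sub_ne_zero.2 hyz)
  have hlog : log (1 + d) - log d ≤ d + |log d| := by
    have := log_le_sub_one_of_pos (show 0 < 1 + d by positivity)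
    have := neg_abs_le (log d)
    linarith
  have hb : ∀ w : Plane, ∫⁻ x in ball 0 R, ENNReal.ofReal (‖x - w‖⁻¹ * (‖x - w‖ + d)⁻¹) ≤
      ENNReal.ofReal (2 * π * (d + |log d|)) + volume (ball (0 : Plane) R) := fun w =>
    (lintegral_ball_inv_dist_mul_le hd R w).trans (by gcongr)
  have hae : ∀ᵐ x ∂(volume : Measure Plane).restrict (ball 0 R), x ≠ y ∧ x ≠ z := by
    refine ae_restrict_of_ae ?_
    have h1 : ∀ᵐ x ∂(volume : Measure Plane), x ≠ y := by simp [ae_iff]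
    have h2 : ∀ᵐ x ∂(volume : Measure Plane), x ≠ z := by simp [ae_iff]
    exact h1.and h2
  calc _ ≤ ∫⁻ x in ball 0 R, (3 * ENNReal.ofReal (‖x - y‖⁻¹ * (‖x - y‖ + d)⁻¹)
        + 3 * ENNReal.ofReal (‖x - z‖⁻¹ * (‖x - z‖ + d)⁻¹)) := by
        refine lintegral_mono_ae ?_
        filter_upwards [hae] with x hx
        have hy : 0 < ‖x - y‖ := norm_pos_iff.2 (sub_ne_zero.2 hx.1)
        have hz : 0 < ‖x - z‖ := norm_pos_iff.2 (sub_ne_zero.2 hx.2)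
        have htri : d ≤ ‖x - y‖ + ‖x - z‖ := by
          have : y - z = -(x - y) + (x - z) := by abel
          simp only [d]
          rw [this]
          exact (norm_add_le _ _).trans (by rw [norm_neg])
        have e3 : (3 : ℝ≥0∞) = ENNReal.ofReal 3 := by simp
        rw [← ofReal_norm, ← ofReal_norm, ← ENNReal.ofReal_inv_of_pos hy,
          ← ENNReal.ofReal_inv_of_pos hz, ← ENNReal.ofReal_mul (by positivity), e3,
          ← ENNReal.ofReal_mul (by norm_num), ← ENNReal.ofReal_mul (by norm_num)]
        rcases le_total ‖x - y‖ ‖x - z‖ with h | h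
        · exact (ENNReal.ofReal_le_ofReal (inv_mul_inv_le_of_le hy hd h htri)).trans le_self_add
        · rw [mul_comm ‖x - y‖⁻¹ ‖x - z‖⁻¹]
          exact (ENNReal.ofReal_le_ofReal
            (inv_mul_inv_le_of_le hz hd h (by linarith))).trans le_add_self
    _ = 3 * (∫⁻ x in ball 0 R, ENNReal.ofReal (‖x - y‖⁻¹ * (‖x - y‖ + d)⁻¹))
        + 3 * ∫⁻ x in ball 0 R, ENNReal.ofReal (‖x - z‖⁻¹ * (‖x - z‖ + d)⁻¹) := by
        rw [lintegral_add_left (by fun_prop), lintegral_const_mul _ (by fun_prop),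
          lintegral_const_mul _ (by fun_prop)]
    _ ≤ 3 * (ENNReal.ofReal (2 * π * (d + |log d|)) + volume (ball (0 : Plane) R))
        + 3 * (ENNReal.ofReal (2 * π * (d + |log d|)) + volume (ball (0 : Plane) R)) := by
        gcongr <;> exact hb _
    _ = _ := by ring

theorem measurable_logKernel : Measurable fun p : Plane × Plane => logKernel p.1 p.2 := by
  unfold logKernel
  fun_prop

theorem logKernel_comm (x y : Plane) : logKernel x y = logKernel y x := by
  unfold logKernel
  rw [dist_comm]

theorem logKernel_eq_neg_log (x y : Plane) : logKernel x y = -log ‖x - y‖ := by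
  unfold logKernel
  rw [one_div, log_inv, dist_eq_norm]

theorem measurable_wKernel : Measurable fun p : Plane × Plane => wKernel p.1 p.2 := by
  unfold wKernel
  refine Measurable.ite (measurableSet_eq_fun measurable_fst measurable_snd) measurable_const ?_
  refine ENNReal.measurable_ofReal.comp ?_
  have := measurable_logKernel
  fun_prop

theorem abs_log_le_add_inv {r : ℝ} (hr : 0 < r) : |log r| ≤ r + r⁻¹ := by
  have h1 := log_le_sub_one_of_pos hr
  have h2 := log_le_sub_one_of_pos (inv_pos.2 hr)
  rw [log_inv] at h2
  have : 0 < r⁻¹ := inv_pos.2 hr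
  rw [abs_le]
  constructor <;> linarith

/-- The real-valued integrand of the weighted energy, shifted by one. -/
noncomputable def energyDensity (p : Plane × Plane) : ℝ :=
  logKernel p.1 p.2 + (‖p.1‖ ^ 2 + ‖p.2‖ ^ 2) / 2 + 1

theorem sq_norm_le_energyDensity {p : Plane × Plane} (hp : p.1 ≠ p.2) :
    (‖p.1‖ ^ 2 + ‖p.2‖ ^ 2) / 4 ≤ energyDensity p := by
  have hr : 0 < ‖p.1 - p.2‖ := norm_pos_iff.2 (sub_ne_zero.2 hp)
  have h1 := log_le_sub_one_of_pos hr
  have h2 := norm_sub_le p.1 p.2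
  unfold energyDensity
  rw [logKernel_eq_neg_log]
  nlinarith [sq_nonneg (‖p.1‖ - 2), sq_nonneg (‖p.2‖ - 2)]

theorem energyDensity_nonneg {p : Plane × Plane} (hp : p.1 ≠ p.2) : 0 ≤ energyDensity p :=
  le_trans (by positivity) (sq_norm_le_energyDensity hp)

/-- The effective potential `2 U^μ + |x|²`. -/
noncomputable def effPot (μ : Measure Plane) (x : Plane) : ℝ := 2 * logPot μ x + ‖x‖ ^ 2

theorem ae_ne_of_wEnergy_lt_top {μ : Measure Plane} (hE : wEnergy μ < ⊤) :
    ∀ᵐ p ∂μ.prod μ, p.1 ≠ p.2 := by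
  filter_upwards [ae_lt_top measurable_wKernel hE.ne] with p hp h
  simp [wKernel, h] at hp

theorem wKernel_ae_eq_energyDensity {μ : Measure Plane} [IsProbabilityMeasure μ] (hE : wEnergy μ < ⊤) :
    (fun p : Plane × Plane => wKernel p.1 p.2) =ᵐ[μ.prod μ]
      fun p => ENNReal.ofReal (energyDensity p) := by
  filter_upwards [ae_ne_of_wEnergy_lt_top hE] with p hp
  simp [wKernel, hp, energyDensity]

theorem energyDensity_ae_nonneg {μ : Measure Plane} [IsProbabilityMeasure μ]
    (hE : wEnergy μ < ⊤) : 0 ≤ᵐ[μ.prod μ] energyDensity := by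
  filter_upwards [ae_ne_of_wEnergy_lt_top hE] with p hp using energyDensity_nonneg hp

theorem integrable_energyDensity {μ : Measure Plane} [IsProbabilityMeasure μ] (hE : wEnergy μ < ⊤) :
    Integrable energyDensity (μ.prod μ) := by
  have hm : AEStronglyMeasurable energyDensity (μ.prod μ) := by
    unfold energyDensity
    have := measurable_logKernel
    exact Measurable.aestronglyMeasurable (by fun_prop)
  refine (lintegral_ofReal_ne_top_iff_integrable hm (energyDensity_ae_nonneg hE)).1 ?_
  rw [← lintegral_congr_ae (wKernel_ae_eq_energyDensity hE)]
  exact hE.ne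

theorem integrable_sq_norm {μ : Measure Plane} [IsProbabilityMeasure μ] (hE : wEnergy μ < ⊤) :
    Integrable (fun x => ‖x‖ ^ 2) μ := by
  have h : Integrable (fun p : Plane × Plane => ‖p.1‖ ^ 2) (μ.prod μ) := by
    refine ((integrable_energyDensity hE).const_mul 4).mono' (by fun_prop) ?_
    filter_upwards [ae_ne_of_wEnergy_lt_top hE] with p hp
    have := sq_norm_le_energyDensity hp
    rw [norm_of_nonneg (by positivity)]
    nlinarith [sq_nonneg ‖p.2‖]
  exact (measurePreserving_fst.integrable_comp (g := fun x : Plane => ‖x‖ ^ 2) (by fun_prop)).1 h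

theorem integrable_norm {μ : Measure Plane} [IsProbabilityMeasure μ] (hE : wEnergy μ < ⊤) :
    Integrable (fun x => ‖x‖) μ := by
  refine ((integrable_sq_norm hE).add (integrable_const (1 : ℝ))).mono' (by fun_prop) ?_
  refine ae_of_all _ fun x => ?_
  simp only [norm_norm, Pi.add_apply]
  nlinarith [sq_nonneg (‖x‖ - 1)]

theorem integrable_logKernel {μ : Measure Plane} [IsProbabilityMeasure μ] (hE : wEnergy μ < ⊤) :
    Integrable (fun p : Plane × Plane => logKernel p.1 p.2) (μ.prod μ) := by
  have h1 : Integrable (fun p : Plane × Plane => ‖p.1‖ ^ 2) (μ.prod μ) :=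
    (integrable_sq_norm hE).comp_fst μ
  have h2 : Integrable (fun p : Plane × Plane => ‖p.2‖ ^ 2) (μ.prod μ) :=
    (integrable_sq_norm hE).comp_snd μ
  have := ((integrable_energyDensity hE).sub ((h1.add h2).div_const 2)).sub
    (integrable_const (1 : ℝ))
  refine this.congr (ae_of_all _ fun p => ?_)
  simp only [energyDensity, Pi.sub_apply, Pi.add_apply]
  ring

theorem integrable_logPot {μ : Measure Plane} [IsProbabilityMeasure μ] (hE : wEnergy μ < ⊤) :
    Integrable (logPot μ) μ :=
  (integrable_logKernel hE).integral_prod_left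

theorem ae_integrable_logKernel {μ : Measure Plane} [IsProbabilityMeasure μ] (hE : wEnergy μ < ⊤) :
    ∀ᵐ y ∂μ, Integrable (fun z => logKernel y z) μ :=
  (integrable_logKernel hE).prod_right_ae

theorem integrable_effPot {μ : Measure Plane} [IsProbabilityMeasure μ] (hE : wEnergy μ < ⊤) :
    Integrable (effPot μ) μ :=
  ((integrable_logPot hE).const_mul 2).add (integrable_sq_norm hE)

theorem integral_energyDensity_right {μ : Measure Plane} [IsProbabilityMeasure μ] (hE : wEnergy μ < ⊤) :
    ∀ᵐ x ∂μ, ∫ y, energyDensity (x, y) ∂μ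
      = effPot μ x / 2 + ((∫ y, ‖y‖ ^ 2 ∂μ) / 2 + 1) := by
  filter_upwards [ae_integrable_logKernel hE] with x hx
  have h2 := integrable_sq_norm hE
  have h3 : Integrable (fun y => (‖x‖ ^ 2 + ‖y‖ ^ 2) / 2) μ :=
    ((integrable_const _).add h2).div_const 2
  have h4 : Integrable (fun y => logKernel x y + (‖x‖ ^ 2 + ‖y‖ ^ 2) / 2) μ := hx.add h3
  simp only [energyDensity]
  rw [integral_add h4 (integrable_const _), integral_add hx h3, integral_div,
    integral_add (integrable_const _) h2]
  simp [effPot, logPot]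
  ring

theorem toReal_lintegral_restrict_prod_wKernel {μ : Measure Plane} [IsProbabilityMeasure μ]
    (hE : wEnergy μ < ⊤) (A : Set Plane) :
    (∫⁻ p, wKernel p.1 p.2 ∂((μ.restrict A).prod μ)).toReal
      = (∫ x in A, effPot μ x ∂μ) / 2 + ((∫ y, ‖y‖ ^ 2 ∂μ) / 2 + 1) * μ.real A := by
  have hle : (μ.restrict A).prod μ ≤ μ.prod μ := by
    have : (μ.restrict A).prod μ = (μ.prod μ).restrict (A ×ˢ Set.univ) := by
      rw [← Measure.prod_restrict, Measure.restrict_univ]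
    rw [this]
    exact Measure.restrict_le_self
  have hac : (μ.restrict A).prod μ ≪ μ.prod μ := hle.absolutelyContinuous
  have hi : Integrable energyDensity ((μ.restrict A).prod μ) :=
    (integrable_energyDensity hE).mono_measure hle
  rw [lintegral_congr_ae (hac.ae_le (wKernel_ae_eq_energyDensity hE)),
    ← ofReal_integral_eq_lintegral_ofReal hi (hac.ae_le (energyDensity_ae_nonneg hE)),
    ENNReal.toReal_ofReal (integral_nonneg_of_ae (hac.ae_le (energyDensity_ae_nonneg hE))),
    integral_prod _ hi, integral_congr_ae (ae_restrict_of_ae (integral_energyDensity_right hE)),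
    integral_add ((integrable_effPot hE).integrableOn.div_const 2) (integrable_const _),
    integral_div]
  simp [mul_comm]

/-- The total effective potential of a probability measure of finite energy is nonnegative. -/
theorem integral_effPot_nonneg {μ : Measure Plane} [IsProbabilityMeasure μ]
    (hE : wEnergy μ < ⊤) : 0 ≤ ∫ x, effPot μ x ∂μ := by
  have h1 : Integrable (fun p : Plane × Plane => ‖p.1‖ ^ 2) (μ.prod μ) :=
    (integrable_sq_norm hE).comp_fst μ
  have h2 : Integrable (fun p : Plane × Plane => ‖p.2‖ ^ 2) (μ.prod μ) :=
    (integrable_sq_norm hE).comp_snd μ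
  have hL := integrable_logKernel hE
  have hid : Integrable (fun x : Plane => x) μ :=
    (integrable_norm_iff (by fun_prop)).1 (integrable_norm hE)
  have hin : Integrable (fun p : Plane × Plane => ⟪p.1, p.2⟫) (μ.prod μ) := by
    refine (h1.add h2).mono' (by fun_prop) (ae_of_all _ fun p => ?_)
    have := norm_inner_le_norm (𝕜 := ℝ) p.1 p.2
    simp only [Pi.add_apply]
    nlinarith [sq_nonneg (‖p.1‖ - ‖p.2‖), sq_nonneg (‖p.1‖), sq_nonneg ‖p.2‖]
  have hinn : 0 ≤ ∫ p : Plane × Plane, ⟪p.1, p.2⟫ ∂μ.prod μ := by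
    rw [integral_prod _ hin]
    simp only [integral_inner hid]
    have : ∀ x : Plane, ⟪x, ∫ y, y ∂μ⟫ = ⟪∫ y, y ∂μ, x⟫ := fun x => real_inner_comm _ _
    simp only [this, integral_inner hid]
    exact real_inner_self_nonneg
  have key : ∫ p : Plane × Plane, (1 - log 2 + ⟪p.1, p.2⟫) ∂μ.prod μ
      ≤ ∫ p : Plane × Plane, (2 * logKernel p.1 p.2 + (‖p.1‖ ^ 2 + ‖p.2‖ ^ 2) / 2) ∂μ.prod μ := by
    refine integral_mono_ae ((integrable_const _).add hin)
      ((hL.const_mul 2).add ((h1.add h2).div_const 2)) ?_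
    filter_upwards [ae_ne_of_wEnergy_lt_top hE] with p hp
    have hr : 0 < ‖p.1 - p.2‖ := norm_pos_iff.2 (sub_ne_zero.2 hp)
    have hs : 0 < ‖p.1 - p.2‖ ^ 2 / 2 := by positivity
    have h := log_le_sub_one_of_pos hs
    rw [log_div (by positivity) two_ne_zero, log_pow, norm_sub_sq_real] at h
    simp only [logKernel_eq_neg_log]
    push_cast at h
    linarith
  have h3 : Integrable (fun p : Plane × Plane => (‖p.1‖ ^ 2 + ‖p.2‖ ^ 2) / 2) (μ.prod μ) :=
    (h1.add h2).div_const 2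
  rw [integral_add (integrable_const _) hin, integral_add (hL.const_mul 2) h3, integral_div, integral_add h1 h2,
    integral_const_mul, integral_prod _ hL, integral_fun_fst (fun x : Plane => ‖x‖ ^ 2),
    integral_fun_snd (fun x : Plane => ‖x‖ ^ 2)] at key
  have hlog : log 2 ≤ 1 := by have := log_le_sub_one_of_pos (show (0 : ℝ) < 2 by norm_num); linarith
  have e : ∫ x, effPot μ x ∂μ = 2 * ∫ x, logPot μ x ∂μ + ∫ x, ‖x‖ ^ 2 ∂μ := by
    simp only [effPot]
    rw [integral_add ((integrable_logPot hE).const_mul 2) (integrable_sq_norm hE),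
      integral_const_mul]
  simp only [integral_const, probReal_univ, smul_eq_mul, one_mul] at key
  rw [e]
  unfold logPot
  linarith

theorem ennreal_mul_le_sq_add_sq (a b : ℝ≥0∞) : a * b ≤ a ^ 2 + b ^ 2 := by
  rcases le_total a b with h | h
  · calc a * b ≤ b * b := by gcongr
      _ = b ^ 2 := (sq b).symm
      _ ≤ _ := le_add_self
  · calc a * b ≤ a * a := by gcongr
      _ = a ^ 2 := (sq a).symm
      _ ≤ _ := le_self_add

theorem ennreal_add_sq_le (a b : ℝ≥0∞) : (a + b) ^ 2 ≤ 4 * a ^ 2 + 4 * b ^ 2 := by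
  rcases le_total a b with h | h
  · calc (a + b) ^ 2 ≤ (b + b) ^ 2 := by gcongr
      _ = 4 * b ^ 2 := by ring
      _ ≤ _ := le_add_self
  · calc (a + b) ^ 2 ≤ (a + a) ^ 2 := by gcongr
      _ = 4 * a ^ 2 := by ring
      _ ≤ _ := le_self_add

/-- A kernel dominating both the logarithmic kernel and its gradient. -/
noncomputable def majKernel (x y : Plane) : ℝ≥0∞ := ‖x‖ₑ + ‖y‖ₑ + ‖x - y‖ₑ⁻¹

noncomputable def majPot (μ : Measure Plane) (x : Plane) : ℝ≥0∞ := ∫⁻ y, majKernel x y ∂μ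

/-- The gradient of `logKernel` in its first variable. -/
noncomputable def logGrad (x y : Plane) : Plane := -((‖x - y‖ ^ 2)⁻¹ • (x - y))

/-- The gradient of the logarithmic potential. -/
noncomputable def gradPot (μ : Measure Plane) (x : Plane) : Plane := ∫ y, logGrad x y ∂μ

theorem measurable_majKernel : Measurable fun p : Plane × Plane => majKernel p.1 p.2 := by
  unfold majKernel
  fun_prop

theorem measurable_majKernel_right (x : Plane) : Measurable (majKernel x) := by
  unfold majKernel
  fun_prop

theorem measurable_logGrad : Measurable fun p : Plane × Plane => logGrad p.1 p.2 := by
  unfold logGrad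
  fun_prop

theorem measurable_majPot (μ : Measure Plane) [SFinite μ] : Measurable (majPot μ) :=
  measurable_majKernel.lintegral_prod_right

theorem stronglyMeasurable_logPot (μ : Measure Plane) [SFinite μ] :
    StronglyMeasurable (logPot μ) :=
  measurable_logKernel.stronglyMeasurable.integral_prod_right

theorem stronglyMeasurable_gradPot (μ : Measure Plane) [SFinite μ] :
    StronglyMeasurable (gradPot μ) :=
  measurable_logGrad.stronglyMeasurable.integral_prod_right

theorem norm_logGrad (x y : Plane) : ‖logGrad x y‖ = ‖x - y‖⁻¹ := by
  unfold logGrad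
  rw [norm_neg, norm_smul, norm_inv, norm_pow, norm_norm]
  rcases eq_or_ne ‖x - y‖ 0 with h | h
  · simp [h]
  · field_simp

theorem enorm_inv_le (r : ℝ) : ‖r⁻¹‖ₑ ≤ ‖r‖ₑ⁻¹ := by
  rcases eq_or_ne r 0 with h | h
  · simp [h]
  · rw [enorm_inv h]

theorem enorm_logGrad_le (x y : Plane) : ‖logGrad x y‖ₑ ≤ majKernel x y := by
  rw [← enorm_norm, norm_logGrad]
  refine (enorm_inv_le _).trans ?_
  rw [enorm_norm]
  exact le_add_self

theorem enorm_logKernel_le (x y : Plane) : ‖logKernel x y‖ₑ ≤ majKernel x y := by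
  unfold majKernel
  rcases eq_or_ne x y with h | h
  · simp [h]
  · have hr : 0 < ‖x - y‖ := norm_pos_iff.2 (sub_ne_zero.2 h)
    have h1 : |logKernel x y| ≤ ‖x‖ + ‖y‖ + ‖x - y‖⁻¹ := by
      rw [logKernel_eq_neg_log, abs_neg]
      exact (abs_log_le_add_inv hr).trans (by gcongr; exact norm_sub_le x y)
    rw [← ofReal_norm, Real.norm_eq_abs]
    refine (ENNReal.ofReal_le_ofReal h1).trans ?_
    rw [ENNReal.ofReal_add (by positivity) (by positivity),
      ENNReal.ofReal_add (by positivity) (by positivity), ofReal_norm, ofReal_norm,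
      ENNReal.ofReal_inv_of_pos hr, ofReal_norm]

theorem enorm_logPot_le (μ : Measure Plane) (x : Plane) : ‖logPot μ x‖ₑ ≤ majPot μ x :=
  (enorm_integral_le_lintegral_enorm _).trans (lintegral_mono fun y => enorm_logKernel_le x y)

theorem enorm_gradPot_le (μ : Measure Plane) (x : Plane) : ‖gradPot μ x‖ₑ ≤ majPot μ x :=
  (enorm_integral_le_lintegral_enorm _).trans (lintegral_mono fun y => enorm_logGrad_le x y)

theorem lintegral_enorm_norm_sub_add_log_lt_top {μ : Measure Plane} [IsProbabilityMeasure μ]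
    (hE : wEnergy μ < ⊤) :
    ∫⁻ p : Plane × Plane, ENNReal.ofReal (2 * π * (‖p.1 - p.2‖ + |log ‖p.1 - p.2‖|)) ∂μ.prod μ
      < ⊤ := by
  have h1 : Integrable (fun p : Plane × Plane => ‖p.1‖) (μ.prod μ) :=
    (integrable_norm hE).comp_fst μ
  have h2 : Integrable (fun p : Plane × Plane => ‖p.2‖) (μ.prod μ) :=
    (integrable_norm hE).comp_snd μ
  have h3 : Integrable (fun p : Plane × Plane => ‖p.1 - p.2‖) (μ.prod μ) :=
    (h1.add h2).mono' (by fun_prop) (ae_of_all _ fun p => by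
      simpa using norm_sub_le p.1 p.2)
  have h4 : Integrable (fun p : Plane × Plane => |log ‖p.1 - p.2‖|) (μ.prod μ) := by
    refine (integrable_logKernel hE).norm.congr (ae_of_all _ fun p => ?_)
    simp [logKernel_eq_neg_log]
  exact ((h3.add h4).const_mul (2 * π)).lintegral_lt_top

theorem lintegral_ball_sq_lintegral_inv_dist_lt_top {μ : Measure Plane} [IsProbabilityMeasure μ]
    (hE : wEnergy μ < ⊤) (R : ℝ) :
    ∫⁻ x in ball 0 R, (∫⁻ y, ‖x - y‖ₑ⁻¹ ∂μ) ^ 2 < ⊤ := by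
  calc ∫⁻ x in ball 0 R, (∫⁻ y, ‖x - y‖ₑ⁻¹ ∂μ) ^ 2
      = ∫⁻ x in ball 0 R, ∫⁻ p : Plane × Plane, ‖x - p.1‖ₑ⁻¹ * ‖x - p.2‖ₑ⁻¹ ∂μ.prod μ := by
        refine lintegral_congr fun x => ?_
        rw [sq, lintegral_prod_mul (f := fun y => ‖x - y‖ₑ⁻¹) (g := fun y => ‖x - y‖ₑ⁻¹)
          (by fun_prop) (by fun_prop)]
    _ = ∫⁻ p : Plane × Plane, ∫⁻ x in ball 0 R, ‖x - p.1‖ₑ⁻¹ * ‖x - p.2‖ₑ⁻¹ ∂volume ∂μ.prod μ :=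
        lintegral_lintegral_swap (by fun_prop)
    _ ≤ ∫⁻ p : Plane × Plane, 6 * (ENNReal.ofReal (2 * π * (‖p.1 - p.2‖ + |log ‖p.1 - p.2‖|))
        + volume (ball (0 : Plane) R)) ∂μ.prod μ := by
        refine lintegral_mono_ae ?_
        filter_upwards [ae_ne_of_wEnergy_lt_top hE] with p hp using
          lintegral_ball_inv_dist_mul_inv_dist_le hp R
    _ < ⊤ := by
        rw [lintegral_const_mul _ (by fun_prop), lintegral_add_right _ measurable_const]
        refine ENNReal.mul_lt_top ENNReal.ofNat_lt_top (ENNReal.add_lt_top.2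
          ⟨lintegral_enorm_norm_sub_add_log_lt_top hE, ?_⟩)
        simpa using (measure_ball_lt_top (μ := (volume : Measure Plane)) (x := 0) (r := R))

theorem lintegral_ball_majPot_sq_lt_top {μ : Measure Plane} [IsProbabilityMeasure μ]
    (hE : wEnergy μ < ⊤) (R : ℝ) : ∫⁻ x in ball 0 R, majPot μ x ^ 2 < ⊤ := by
  have hc : ∫⁻ y, ‖y‖ₑ ∂μ < ⊤ := by
    have h := (integrable_norm hE).hasFiniteIntegral
    simpa [HasFiniteIntegral, enorm_norm] using h
  have hm : Measurable fun x : Plane => ∫⁻ y, ‖x - y‖ₑ⁻¹ ∂μ :=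
    Measurable.lintegral_prod_right (f := fun x y : Plane => ‖x - y‖ₑ⁻¹)
      (by unfold Function.uncurry; fun_prop)
  calc ∫⁻ x in ball 0 R, majPot μ x ^ 2
      ≤ ∫⁻ x in ball 0 R, (4 * (ENNReal.ofReal R + ∫⁻ y, ‖y‖ₑ ∂μ) ^ 2
        + 4 * (∫⁻ y, ‖x - y‖ₑ⁻¹ ∂μ) ^ 2) := by
        refine setLIntegral_mono (by fun_prop) fun x hx => ?_
        have hx : ‖x‖ₑ ≤ ENNReal.ofReal R := by
          rw [← ofReal_norm]
          exact ENNReal.ofReal_le_ofReal (by simpa using (mem_ball_zero_iff.1 hx).le)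
        refine le_trans ?_ (ennreal_add_sq_le _ _)
        gcongr
        unfold majPot majKernel
        rw [lintegral_add_left (by fun_prop), lintegral_add_left (by fun_prop)]
        simpa using add_le_add_left (add_le_add_left hx _) _
    _ < ⊤ := by
        rw [lintegral_add_left measurable_const, lintegral_const,
          lintegral_const_mul _ (hm.pow_const 2)]
        refine ENNReal.add_lt_top.2 ⟨?_, ENNReal.mul_lt_top ENNReal.ofNat_lt_top
          (lintegral_ball_sq_lintegral_inv_dist_lt_top hE R)⟩
        have : ENNReal.ofReal R + ∫⁻ y, ‖y‖ₑ ∂μ < ⊤ :=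
          ENNReal.add_lt_top.2 ⟨ENNReal.ofReal_lt_top, hc⟩
        refine ENNReal.mul_lt_top (ENNReal.mul_lt_top ENNReal.ofNat_lt_top (ENNReal.pow_lt_top this)) ?_
        simpa using (measure_ball_lt_top (μ := (volume : Measure Plane)) (x := 0) (r := R))

theorem ae_majPot_lt_top {μ : Measure Plane} [IsProbabilityMeasure μ] (hE : wEnergy μ < ⊤) :
    ∀ᵐ x, majPot μ x < ⊤ := by
  have h : ∀ n : ℕ, ∀ᵐ x, x ∈ ball (0 : Plane) n → majPot μ x < ⊤ := fun n => by
    rw [← ae_restrict_iff' measurableSet_ball]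
    filter_upwards [ae_lt_top ((measurable_majPot μ).pow_const 2)
      (lintegral_ball_majPot_sq_lt_top hE n).ne] with x hx
    simpa using hx
  filter_upwards [ae_all_iff.2 h] with x hx
  obtain ⟨n, hn⟩ := exists_nat_gt ‖x‖
  exact hx n (by simpa using hn)

theorem integrable_logKernel_of_majPot_lt_top {μ : Measure Plane} {x : Plane}
    (hx : majPot μ x < ⊤) : Integrable (fun y => logKernel x y) μ :=
  ⟨(measurable_logKernel.comp measurable_prodMk_left).aestronglyMeasurable,
    (lintegral_mono fun y => enorm_logKernel_le x y).trans_lt hx⟩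

theorem integrable_logGrad_of_majPot_lt_top {μ : Measure Plane} {x : Plane}
    (hx : majPot μ x < ⊤) : Integrable (fun y => logGrad x y) μ :=
  ⟨(measurable_logGrad.comp measurable_prodMk_left).aestronglyMeasurable,
    (lintegral_mono fun y => enorm_logGrad_le x y).trans_lt hx⟩

theorem locSqInt_of_enorm_le_majPot {E : Type*} [NormedAddCommGroup E] {μ : Measure Plane}
    [IsProbabilityMeasure μ] (hE : wEnergy μ < ⊤) {f : Plane → E}
    (hf : ∀ x, ‖f x‖ₑ ≤ majPot μ x) : LocSqInt f := by
  intro K hK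
  obtain ⟨R, hR⟩ := hK.isBounded.subset_ball 0
  calc ∫⁻ x in K, ‖f x‖ₑ ^ 2 ≤ ∫⁻ x in ball 0 R, ‖f x‖ₑ ^ 2 := lintegral_mono_set hR
    _ ≤ ∫⁻ x in ball 0 R, majPot μ x ^ 2 := lintegral_mono fun x => by gcongr; exact hf x
    _ < ⊤ := lintegral_ball_majPot_sq_lt_top hE R

theorem LocSqInt.locallyIntegrable {E : Type*} [NormedAddCommGroup E] {f : Plane → E}
    (hf : LocSqInt f) (hm : AEStronglyMeasurable f volume) : LocallyIntegrable f := by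
  rw [locallyIntegrable_iff]
  refine fun K hK => ⟨hm.restrict, ?_⟩
  calc ∫⁻ x in K, ‖f x‖ₑ ≤ ∫⁻ x in K, (‖f x‖ₑ ^ 2 + 1) := by
        refine lintegral_mono fun x => ?_
        simpa using ennreal_mul_le_sq_add_sq ‖f x‖ₑ 1
    _ = (∫⁻ x in K, ‖f x‖ₑ ^ 2) + volume K := by
        rw [lintegral_add_right _ measurable_const]; simp
    _ < ⊤ := ENNReal.add_lt_top.2 ⟨hf K hK, hK.measure_lt_top⟩

/-- Joint integrability of functions dominated by a compactly supported `L²` function times the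
majorant kernel. -/
theorem integrable_prod_of_enorm_le_mul_majKernel {E : Type*} [NormedAddCommGroup E]
    {μ : Measure Plane} [IsProbabilityMeasure μ] (hE : wEnergy μ < ⊤) {G : Plane × Plane → E}
    (hG : AEStronglyMeasurable G (volume.prod μ)) {g : Plane → ℝ≥0∞} {R : ℝ}
    (hg2 : ∫⁻ x in ball 0 R, g x ^ 2 < ⊤)
    (hg0 : ∀ᵐ x, x ∉ ball (0 : Plane) R → g x = 0)
    (hle : ∀ x y, ‖G (x, y)‖ₑ ≤ g x * majKernel x y) : Integrable G (volume.prod μ) := by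
  refine ⟨hG, ?_⟩
  calc ∫⁻ p, ‖G p‖ₑ ∂volume.prod μ = ∫⁻ x, ∫⁻ y, ‖G (x, y)‖ₑ ∂μ := lintegral_prod _ hG.enorm
    _ ≤ ∫⁻ x, g x * majPot μ x := by
        refine lintegral_mono fun x => ?_
        unfold majPot
        rw [← lintegral_const_mul _ (measurable_majKernel_right x)]
        exact lintegral_mono (hle x)
    _ ≤ ∫⁻ x in ball 0 R, g x * majPot μ x := by
        rw [← lintegral_indicator measurableSet_ball]
        refine lintegral_mono_ae ?_
        filter_upwards [hg0] with x hx
        by_cases h : x ∈ ball (0 : Plane) R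
        · simp [Set.indicator_of_mem h]
        · simp [hx h]
    _ ≤ ∫⁻ x in ball 0 R, (g x ^ 2 + majPot μ x ^ 2) :=
        lintegral_mono fun x => ennreal_mul_le_sq_add_sq _ _
    _ < ⊤ := by
        rw [lintegral_add_right _ ((measurable_majPot μ).pow_const 2)]
        exact ENNReal.add_lt_top.2 ⟨hg2, lintegral_ball_majPot_sq_lt_top hE R⟩

theorem locallyIntegrable_inv_norm : LocallyIntegrable (fun x : Plane => ‖x‖⁻¹) := by
  refine locallyIntegrable_of_norm_le_rpow (C := 1) (α := 1) (by simp [finrank_euclideanSpace])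
    (by simp [finrank_euclideanSpace]) (ae_of_all _ fun x => ?_)
    (by fun_prop)
  rw [rpow_neg_one, norm_inv, norm_norm, one_mul]

theorem integrable_inv_norm_sub_mul {ψ : Plane → ℝ} (hψ : Continuous ψ)
    (hc : HasCompactSupport ψ) (y : Plane) : Integrable fun x => ‖x - y‖⁻¹ * ψ x := by
  have h1 : HasCompactSupport fun x => ψ (x + y) :=
    hc.comp_homeomorph (Homeomorph.addRight y)
  have h := locallyIntegrable_inv_norm.integrable_smul_left_of_hasCompactSupport
    (show Continuous fun x => ψ (x + y) by fun_prop) h1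
  refine (h.comp_sub_right y).congr (ae_of_all _ fun x => ?_)
  simp [mul_comm]

/-- A smooth regularization of the logarithmic kernel. -/
noncomputable def regLog (y : Plane) (ε : ℝ) (x : Plane) : ℝ := -(log (‖x - y‖ ^ 2 + ε ^ 2) / 2)

theorem hasFDerivAt_regLog (y : Plane) {ε : ℝ} (hε : 0 < ε) (x : Plane) :
    HasFDerivAt (regLog y ε) (-((‖x - y‖ ^ 2 + ε ^ 2)⁻¹ • innerSL ℝ (x - y))) x := by
  have h1 : HasFDerivAt (fun x : Plane => ‖x - y‖ ^ 2) (2 • innerSL ℝ (x - y)) x := by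
    simpa using ((hasFDerivAt_id x).sub_const y).norm_sq
  have h2 := ((h1.add_const (ε ^ 2)).log (by positivity)).const_mul (-(1 / 2))
  have h3 : regLog y ε = fun x => -(1 / 2) * log (‖x - y‖ ^ 2 + ε ^ 2) := by
    ext x
    unfold regLog
    ring
  rw [h3]
  refine h2.congr_fderiv ?_
  ext v
  simp only [smul_apply, neg_apply, smul_eq_mul,
    nsmul_eq_mul]
  push_cast
  ring

theorem abs_regLog_le {y x : Plane} (hxy : x ≠ y) {ε : ℝ} (hε : 0 < ε) (hε1 : ε ≤ 1) :
    |regLog y ε x| ≤ ‖x - y‖⁻¹ + ‖x - y‖ ^ 2 := by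
  have hr : 0 < ‖x - y‖ := norm_pos_iff.2 (sub_ne_zero.2 hxy)
  have hi : 0 < ‖x - y‖⁻¹ := inv_pos.2 hr
  have h1 := log_le_sub_one_of_pos (show 0 < ‖x - y‖ ^ 2 + ε ^ 2 by positivity)
  have h2 : log (‖x - y‖ ^ 2) ≤ log (‖x - y‖ ^ 2 + ε ^ 2) :=
    log_le_log (by positivity) (by nlinarith)
  have h3 := log_le_sub_one_of_pos hi
  rw [log_inv] at h3
  rw [log_pow] at h2
  push_cast at h2
  unfold regLog
  rw [abs_le]
  constructor <;> nlinarith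

theorem integral_logKernel_mul_fderiv {φ : Plane → ℝ} (hφ : ContDiff ℝ (⊤ : ℕ∞) φ)
    (hc : HasCompactSupport φ) (v y : Plane) :
    ∫ x, logKernel x y * fderiv ℝ φ x v = -∫ x, φ x * ⟪logGrad x y, v⟫ := by
  have hd1 : Continuous fun x => fderiv ℝ φ x v :=
    (hφ.continuous_fderiv (by simp)).clm_apply continuous_const
  have hd2 : HasCompactSupport fun x => fderiv ℝ φ x v := hc.fderiv_apply (𝕜 := ℝ) v
  have hne : ∀ᵐ x ∂(volume : Measure Plane), x ≠ y := by simp [ae_iff]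
  set ε : ℕ → ℝ := fun n => 1 / ((n : ℝ) + 1)
  have hε : ∀ n, 0 < ε n := fun n => Nat.one_div_pos_of_nat
  have hε1 : ∀ n, ε n ≤ 1 := fun n => by
    simp only [ε]
    rw [div_le_one (by positivity)]
    linarith [n.cast_nonneg (α := ℝ)]
  have hε0 : Tendsto ε atTop (𝓝 0) := tendsto_one_div_add_atTop_nhds_zero_nat
  have hreg : ∀ n, Continuous (regLog y (ε n)) := fun n =>
    continuous_iff_continuousAt.2 fun x => (hasFDerivAt_regLog y (hε n) x).continuousAt
  have hibp : ∀ n, ∫ x, regLog y (ε n) x * fderiv ℝ φ x v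
      = -∫ x, -((‖x - y‖ ^ 2 + ε n ^ 2)⁻¹ * ⟪x - y, v⟫) * φ x := by
    intro n
    have hfd : ∀ x, fderiv ℝ (regLog y (ε n)) x v = -((‖x - y‖ ^ 2 + ε n ^ 2)⁻¹ * ⟪x - y, v⟫) :=
      fun x => by rw [(hasFDerivAt_regLog y (hε n) x).fderiv]; rfl
    have hcont : Continuous fun x => -((‖x - y‖ ^ 2 + ε n ^ 2)⁻¹ * ⟪x - y, v⟫) := by
      refine (Continuous.mul (Continuous.inv₀ (by fun_prop) fun x => ?_) (by fun_prop)).neg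
      have := hε n
      positivity
    simp only [← hfd] at hcont ⊢
    refine integral_mul_fderiv_eq_neg_fderiv_mul_of_integrable ?_ ?_ ?_ ?_ ?_
    · exact (hcont.mul hφ.continuous).integrable_of_hasCompactSupport hc.mul_left
    · exact ((hreg n).mul hd1).integrable_of_hasCompactSupport hd2.mul_left
    · exact ((hreg n).mul hφ.continuous).integrable_of_hasCompactSupport hc.mul_left
    · exact fun x _ => (hasFDerivAt_regLog y (hε n) x).differentiableAt
    · exact fun x _ => hφ.contDiffAt.differentiableAt (by simp)
  have hlim1 : Tendsto (fun n => ∫ x, regLog y (ε n) x * fderiv ℝ φ x v) atTop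
      (𝓝 (∫ x, logKernel x y * fderiv ℝ φ x v)) := by
    refine tendsto_integral_of_dominated_convergence
      (fun x => ‖x - y‖⁻¹ * |fderiv ℝ φ x v| + ‖x - y‖ ^ 2 * |fderiv ℝ φ x v|)
      (fun n => ((hreg n).mul hd1).aestronglyMeasurable) ?_ (fun n => ?_) ?_
    · refine (integrable_inv_norm_sub_mul hd1.abs hd2.norm y).add ?_
      refine Continuous.integrable_of_hasCompactSupport (by fun_prop) hd2.norm.mul_left
    · filter_upwards [hne] with x hx
      rw [norm_mul, Real.norm_eq_abs, Real.norm_eq_abs, ← add_mul]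
      gcongr
      exact abs_regLog_le hx (hε n) (hε1 n)
    · filter_upwards [hne] with x hx
      refine Tendsto.mul_const _ ?_
      have hr : 0 < ‖x - y‖ := norm_pos_iff.2 (sub_ne_zero.2 hx)
      have : logKernel x y = -(log (‖x - y‖ ^ 2 + 0 ^ 2) / 2) := by
        rw [logKernel_eq_neg_log, zero_pow two_ne_zero, add_zero, log_pow]
        push_cast
        ring
      rw [this]
      unfold regLog
      exact ((((hε0.pow 2).const_add _).log (by positivity)).div_const 2).neg
  have hlim2 : Tendsto (fun n => -∫ x, -((‖x - y‖ ^ 2 + ε n ^ 2)⁻¹ * ⟪x - y, v⟫) * φ x) atTop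
      (𝓝 (-∫ x, φ x * ⟪logGrad x y, v⟫)) := by
    refine Tendsto.neg (tendsto_integral_of_dominated_convergence
      (fun x => ‖v‖ * (‖x - y‖⁻¹ * |φ x|)) (fun n => ?_)
      ((integrable_inv_norm_sub_mul hφ.continuous.abs hc.norm y).const_mul _) (fun n => ?_) ?_)
    · have := hφ.continuous.measurable
      exact Measurable.aestronglyMeasurable (by fun_prop)
    · filter_upwards [hne] with x hx
      have hr : 0 < ‖x - y‖ := norm_pos_iff.2 (sub_ne_zero.2 hx)
      rw [norm_mul, norm_neg, norm_mul, norm_inv, Real.norm_eq_abs (φ x),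
        Real.norm_of_nonneg (by positivity : 0 ≤ ‖x - y‖ ^ 2 + ε n ^ 2), ← mul_assoc]
      refine mul_le_mul_of_nonneg_right ?_ (abs_nonneg _)
      calc (‖x - y‖ ^ 2 + ε n ^ 2)⁻¹ * ‖⟪x - y, v⟫‖
          ≤ (‖x - y‖ ^ 2)⁻¹ * (‖x - y‖ * ‖v‖) := by
            gcongr
            · nlinarith [hε n]
            · exact norm_inner_le_norm _ _
        _ = _ := by field_simp
    · filter_upwards [hne] with x hx
      have hr : 0 < ‖x - y‖ := norm_pos_iff.2 (sub_ne_zero.2 hx)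
      have : φ x * ⟪logGrad x y, v⟫ = -((‖x - y‖ ^ 2 + 0 ^ 2)⁻¹ * ⟪x - y, v⟫) * φ x := by
        rw [logGrad, inner_neg_left, real_inner_smul_left, zero_pow two_ne_zero, add_zero]
        ring
      rw [this]
      exact (((((hε0.pow 2).const_add _).inv₀ (by positivity)).mul_const _).neg).mul_const _
  exact tendsto_nhds_unique hlim1 (by simpa only [hibp] using hlim2)

theorem integral_inner_logGrad_left {μ : Measure Plane} {x : Plane} (hx : majPot μ x < ⊤)
    (v : Plane) : ∫ y, ⟪logGrad x y, v⟫ ∂μ = ⟪gradPot μ x, v⟫ := by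
  simp only [real_inner_comm v]
  exact integral_inner (integrable_logGrad_of_majPot_lt_top hx) v

theorem Continuous.lintegral_ball_enorm_sq_lt_top {ψ : Plane → ℝ} (hψ : Continuous ψ) (R : ℝ) :
    ∫⁻ x in ball 0 R, ‖ψ x‖ₑ ^ 2 < ⊤ := by
  have h : IntegrableOn (fun x => ψ x ^ 2) (ball 0 R) :=
    ((hψ.pow 2).continuousOn.integrableOn_compact (isCompact_closedBall 0 R)).mono_set
      ball_subset_closedBall
  have := h.hasFiniteIntegral
  simpa [HasFiniteIntegral, enorm_pow] using this

theorem hasWeakGradient_logPot {μ : Measure Plane} [IsProbabilityMeasure μ]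
    (hE : wEnergy μ < ⊤) : HasWeakGradient (logPot μ) (gradPot μ) := by
  refine ⟨(locSqInt_of_enorm_le_majPot hE (enorm_logPot_le μ)).locallyIntegrable
      (stronglyMeasurable_logPot μ).aestronglyMeasurable,
    (locSqInt_of_enorm_le_majPot hE (enorm_gradPot_le μ)).locallyIntegrable
      (stronglyMeasurable_gradPot μ).aestronglyMeasurable, fun φ hφ hc v => ?_⟩
  have hd1 : Continuous fun x => fderiv ℝ φ x v :=
    (hφ.continuous_fderiv (by simp)).clm_apply continuous_const
  have hd2 : HasCompactSupport fun x => fderiv ℝ φ x v := hc.fderiv_apply (𝕜 := ℝ) v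
  have hvanish : ∀ {ψ : Plane → ℝ}, HasCompactSupport ψ →
      ∃ R : ℝ, ∀ x, x ∉ ball (0 : Plane) R → ψ x = 0 := by
    intro ψ hψ
    obtain ⟨R, hR⟩ := hψ.isCompact.isBounded.subset_ball 0
    exact ⟨R, fun x hx => image_eq_zero_of_notMem_tsupport fun h => hx (hR h)⟩
  have hi1 : Integrable (fun p : Plane × Plane => logKernel p.1 p.2 * fderiv ℝ φ p.1 v)
      (volume.prod μ) := by
    obtain ⟨R, hR⟩ := hvanish hd2
    refine integrable_prod_of_enorm_le_mul_majKernel hE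
      (measurable_logKernel.mul (hd1.measurable.comp measurable_fst)).aestronglyMeasurable
      (g := fun x => ‖fderiv ℝ φ x v‖ₑ) (R := R) (hd1.lintegral_ball_enorm_sq_lt_top R)
      (ae_of_all _ fun x hx => by simp [hR x hx]) fun x y => ?_
    rw [enorm_mul, mul_comm]
    gcongr
    exact enorm_logKernel_le x y
  have hi2 : Integrable (fun p : Plane × Plane => φ p.1 * ⟪logGrad p.1 p.2, v⟫)
      (volume.prod μ) := by
    obtain ⟨R, hR⟩ := hvanish hc
    have hψ : Continuous fun x => φ x * ‖v‖ := hφ.continuous.mul continuous_const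
    refine integrable_prod_of_enorm_le_mul_majKernel hE
      ((hφ.continuous.measurable.comp measurable_fst).mul
        (measurable_logGrad.inner measurable_const)).aestronglyMeasurable
      (g := fun x => ‖φ x * ‖v‖‖ₑ) (R := R) (hψ.lintegral_ball_enorm_sq_lt_top R)
      (ae_of_all _ fun x hx => by simp [hR x hx]) fun x y => ?_
    calc ‖φ x * ⟪logGrad x y, v⟫‖ₑ ≤ ‖φ x‖ₑ * (‖logGrad x y‖ₑ * ‖v‖ₑ) := by
          rw [enorm_mul]
          gcongr
          rw [← ofReal_norm, ← ofReal_norm, ← ofReal_norm, ← ENNReal.ofReal_mul (norm_nonneg _)]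
          exact ENNReal.ofReal_le_ofReal (norm_inner_le_norm _ _)
      _ ≤ ‖φ x‖ₑ * (majKernel x y * ‖v‖ₑ) := by gcongr; exact enorm_logGrad_le x y
      _ = _ := by rw [enorm_mul, enorm_norm]; ring
  calc ∫ x, logPot μ x * fderiv ℝ φ x v
      = ∫ x, ∫ y, logKernel x y * fderiv ℝ φ x v ∂μ := by
        simp only [integral_mul_const]; rfl
    _ = ∫ y, ∫ x, logKernel x y * fderiv ℝ φ x v ∂volume ∂μ := integral_integral_swap hi1
    _ = -∫ y, ∫ x, φ x * ⟪logGrad x y, v⟫ ∂volume ∂μ := by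
        simp only [integral_logKernel_mul_fderiv hφ hc, integral_neg]
    _ = -∫ x, ∫ y, φ x * ⟪logGrad x y, v⟫ ∂μ := by
        rw [← integral_integral_swap (f := fun x y => φ x * ⟪logGrad x y, v⟫) hi2]
    _ = -∫ x, φ x * ⟪gradPot μ x, v⟫ := by
        congr 1
        refine integral_congr_ae ?_
        filter_upwards [ae_majPot_lt_top hE] with x hx
        rw [integral_const_mul, integral_inner_logGrad_left hx]

theorem LocSqInt.sub {E : Type*} [NormedAddCommGroup E] {f g : Plane → E} (hf : LocSqInt f)
    (hg : LocSqInt g) (hm : AEStronglyMeasurable f volume) : LocSqInt fun x => f x - g x := by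
  intro K hK
  have h1 : ∀ x, ((‖f x - g x‖₊ : ℝ≥0∞)) ^ 2
      ≤ 4 * (‖f x‖₊ : ℝ≥0∞) ^ 2 + 4 * (‖g x‖₊ : ℝ≥0∞) ^ 2 := fun x => by
    refine le_trans ?_ (ennreal_add_sq_le _ _)
    gcongr
    exact enorm_sub_le
  refine (lintegral_mono h1).trans_lt ?_
  have h2 : AEMeasurable (fun x => 4 * (‖f x‖₊ : ℝ≥0∞) ^ 2) (volume.restrict K) :=
    (hm.restrict.enorm.pow_const 2).const_mul 4
  rw [lintegral_add_left' h2,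
    lintegral_const_mul' _ _ (by simp), lintegral_const_mul' _ _ (by simp)]
  exact ENNReal.add_lt_top.2 ⟨ENNReal.mul_lt_top (by simp) (hf K hK),
    ENNReal.mul_lt_top (by simp) (hg K hK)⟩

theorem HasWeakGradient.sub {u₁ u₂ : Plane → ℝ} {w₁ w₂ : Plane → Plane}
    (h₁ : HasWeakGradient u₁ w₁) (h₂ : HasWeakGradient u₂ w₂) :
    HasWeakGradient (fun x => u₁ x - u₂ x) (fun x => w₁ x - w₂ x) := by
  refine ⟨h₁.1.sub h₂.1, h₁.2.1.sub h₂.2.1, fun φ hφ hc v => ?_⟩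
  have hd1 : Continuous fun x => fderiv ℝ φ x v :=
    (hφ.continuous_fderiv (by simp)).clm_apply continuous_const
  have hd2 : HasCompactSupport fun x => fderiv ℝ φ x v := hc.fderiv_apply (𝕜 := ℝ) v
  have hu : ∀ {u : Plane → ℝ}, LocallyIntegrable u →
      Integrable fun x => u x * fderiv ℝ φ x v := fun hu =>
    (hu.integrable_smul_right_of_hasCompactSupport hd1 hd2)
  have hw : ∀ {w : Plane → Plane}, LocallyIntegrable w →
      Integrable fun x => φ x * ⟪w x, v⟫ := fun hw => by
    refine ((hw.integrable_smul_left_of_hasCompactSupport hφ.continuous hc).inner_const v).congr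
      (ae_of_all _ fun x => ?_)
    exact real_inner_smul_left _ _ _
  simp only [sub_mul, inner_sub_left, mul_sub]
  rw [integral_sub (hu h₁.1) (hu h₂.1), integral_sub (hw h₁.2.1) (hw h₂.2.1),
    h₁.2.2 φ hφ hc v, h₂.2.2 φ hφ hc v]
  ring

theorem HasWeakGradient.ae_eq_zero {f : Plane → ℝ} {g : Plane → Plane}
    (h : HasWeakGradient f g) : ∀ᵐ x, x ∉ tsupport f → g x = 0 := by
  refine (isClosed_tsupport f).isOpen_compl.ae_eq_zero_of_integral_contDiff_smul_eq_zero
    (h.2.1.locallyIntegrableOn _) fun φ hφ hc hs => ?_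
  have hi : Integrable fun x => φ x • g x :=
    h.2.1.integrable_smul_left_of_hasCompactSupport hφ.continuous hc
  refine ext_inner_right ℝ fun v => ?_
  have h1 : ∫ x, f x * fderiv ℝ φ x v = 0 := by
    refine integral_eq_zero_of_ae (ae_of_all _ fun x => ?_)
    by_cases hx : x ∈ tsupport f
    · have : x ∉ tsupport φ := fun hx' => hs hx' hx
      have h2 : fderiv ℝ φ x = 0 := by
        by_contra hne
        exact this (support_fderiv_subset ℝ hne)
      simp [h2]
    · simp [image_eq_zero_of_notMem_tsupport hx]
  have h2 := h.2.2 φ hφ hc v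
  rw [h1] at h2
  rw [inner_zero_left, real_inner_comm, ← integral_inner hi]
  simp only [real_inner_comm _ v, real_inner_smul_left]
  linarith

theorem HasWeakGradient.integral_mul_fderiv {f : Plane → ℝ} {g : Plane → Plane}
    (h : HasWeakGradient f g) (hf : HasCompactSupport f) {φ : Plane → ℝ}
    (hφ : ContDiff ℝ (⊤ : ℕ∞) φ) (v : Plane) :
    ∫ x, f x * fderiv ℝ φ x v = -∫ x, φ x * ⟪g x, v⟫ := by
  obtain ⟨R, hR0, hR⟩ := hf.isCompact.isBounded.subset_ball_lt 0 0
  let χ : ContDiffBump (0 : Plane) := ⟨R, R + 1, hR0, by linarith⟩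
  have h1 := h.2.2 (fun x => χ x * φ x) (χ.contDiff.mul hφ) χ.hasCompactSupport.mul_right v
  have e1 : ∀ x, f x * fderiv ℝ (fun x => χ x * φ x) x v = f x * fderiv ℝ φ x v := by
    intro x
    by_cases hx : x ∈ tsupport f
    · have : (fun x => χ x * φ x) =ᶠ[𝓝 x] φ := by
        filter_upwards [isOpen_ball.mem_nhds (hR hx)] with z hz
        rw [χ.one_of_mem_closedBall (ball_subset_closedBall hz), one_mul]
      rw [this.fderiv_eq]
    · simp [image_eq_zero_of_notMem_tsupport hx]
  have e2 : ∫ x, χ x * φ x * ⟪g x, v⟫ = ∫ x, φ x * ⟪g x, v⟫ := by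
    refine integral_congr_ae ?_
    filter_upwards [h.ae_eq_zero] with x hx
    by_cases hx' : x ∈ tsupport f
    · rw [χ.one_of_mem_closedBall (ball_subset_closedBall (hR hx')), one_mul]
    · simp [hx hx']
  simpa only [e1, e2] using h1

/-- The Laplacian of the regularized logarithmic kernel, up to the factor `-2π`. -/
noncomputable def approxDelta (ε : ℝ) (z : Plane) : ℝ :=
  ε ^ 2 / (π * (‖z‖ ^ 2 + ε ^ 2) ^ 2)

theorem approxDelta_nonneg (ε : ℝ) (z : Plane) : 0 ≤ approxDelta ε z := by
  unfold approxDelta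
  positivity

theorem continuous_approxDelta {ε : ℝ} (hε : 0 < ε) : Continuous (approxDelta ε) := by
  unfold approxDelta
  refine continuous_const.div (by fun_prop) fun x => ?_
  positivity

theorem integral_approxDelta {ε : ℝ} (hε : 0 < ε) : ∫ z, approxDelta ε z = 1 := by
  have h := integral_fun_norm_plane fun r => ε ^ 2 / (π * (r ^ 2 + ε ^ 2) ^ 2)
  have hd : ∀ r ∈ Set.Ici (0 : ℝ), HasDerivAt (fun r => -(ε ^ 2 / (2 * π) * (r ^ 2 + ε ^ 2)⁻¹))
      (r * (ε ^ 2 / (π * (r ^ 2 + ε ^ 2) ^ 2))) r := by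
    intro r _
    have h0 : r ^ 2 + ε ^ 2 ≠ 0 := by positivity
    have h1 := ((((hasDerivAt_id r).pow 2).add_const (ε ^ 2)).inv h0).const_mul (ε ^ 2 / (2 * π))
    refine h1.neg.congr_deriv ?_
    simp only [id_eq, Pi.pow_apply, Nat.cast_ofNat, Nat.add_one_sub_one, pow_one, mul_one]
    field_simp
  have hl : Tendsto (fun r : ℝ => -(ε ^ 2 / (2 * π) * (r ^ 2 + ε ^ 2)⁻¹)) atTop (𝓝 0) := by
    have h1 : Tendsto (fun r : ℝ => r ^ 2 + ε ^ 2) atTop atTop :=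
      tendsto_atTop_add_const_right _ _ (tendsto_pow_atTop two_ne_zero)
    simpa using (h1.inv_tendsto_atTop.const_mul (ε ^ 2 / (2 * π))).neg
  have hi := integral_Ioi_of_hasDerivAt_of_nonneg' hd
    (fun r hr => mul_nonneg (le_of_lt hr) (by positivity)) hl
  rw [hi] at h
  unfold approxDelta
  rw [h]
  field_simp
  simp

theorem integrable_approxDelta {ε : ℝ} (hε : 0 < ε) : Integrable (approxDelta ε) := by
  by_contra h
  have := integral_approxDelta hε
  rw [integral_undef h] at this
  exact zero_ne_one this

theorem fderiv_inner_div {ε : ℝ} (hε : 0 < ε) (y v x : Plane) :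
    fderiv ℝ (fun x => -(⟪x - y, v⟫ * (‖x - y‖ ^ 2 + ε ^ 2)⁻¹)) x v
      = -(‖v‖ ^ 2 * (‖x - y‖ ^ 2 + ε ^ 2)⁻¹
        - 2 * ⟪x - y, v⟫ ^ 2 * ((‖x - y‖ ^ 2 + ε ^ 2) ^ 2)⁻¹) := by
  have h0 : ‖x - y‖ ^ 2 + ε ^ 2 ≠ 0 := by positivity
  have h1 : HasFDerivAt (fun x : Plane => ‖x - y‖ ^ 2) (2 • innerSL ℝ (x - y)) x := by
    simpa using ((hasFDerivAt_id x).sub_const y).norm_sq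
  have h2 : HasFDerivAt (fun x : Plane => ⟪x - y, v⟫) (innerSL ℝ v) x := by
    have := (innerSL ℝ v).hasFDerivAt (x := x - y) |>.comp x ((hasFDerivAt_id x).sub_const y)
    refine (this.congr_fderiv (by ext; simp)).congr_of_eventuallyEq (Eventually.of_forall fun z => ?_)
    simp [real_inner_comm]
  have h3 := (hasDerivAt_inv h0).comp_hasFDerivAt x (h1.add_const (ε ^ 2))
  have h4 := (h2.mul h3).neg
  have h5 := h4.fderiv
  simp only [Function.comp_def] at h5
  rw [show (fun x => -(⟪x - y, v⟫ * (‖x - y‖ ^ 2 + ε ^ 2)⁻¹)) =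
    -((fun x => ⟪x - y, v⟫) * fun x => (‖x - y‖ ^ 2 + ε ^ 2)⁻¹) from rfl, h5]
  simp
  field_simp
  rw [inner_sub_left]
  ring

theorem integrable_mul_of_hasCompactSupport {f ψ : Plane → ℝ} (hf : LocallyIntegrable f)
    (hc : HasCompactSupport f) (hψ : Continuous ψ) : Integrable fun x => f x * ψ x := by
  have h : IntegrableOn (fun x => f x * ψ x) (tsupport f) :=
    (hf.integrableOn_isCompact hc.isCompact).mul_continuousOn hψ.continuousOn hc.isCompact
  refine (integrableOn_iff_integrable_of_support_subset fun x hx => ?_).1 h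
  exact subset_tsupport f (left_ne_zero_of_mul hx)

theorem inv_sq_add_sq_mul_le {ε : ℝ} (r : ℝ) (hε : 0 < ε) :
    (r ^ 2 + ε ^ 2)⁻¹ * r ≤ ε⁻¹ := by
  rw [inv_mul_le_iff₀ (by positivity), ← div_eq_mul_inv, le_div_iff₀ hε]
  nlinarith [sq_nonneg (r - ε), sq_nonneg (r + ε)]

theorem HasWeakGradient.integral_mul_approxDelta {f : Plane → ℝ} {g : Plane → Plane}
    (h : HasWeakGradient f g) (hf : HasCompactSupport f) (hg : Integrable g) {ε : ℝ} (hε : 0 < ε)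
    (y : Plane) :
    2 * π * ∫ x, f x * approxDelta ε (x - y)
      = ∫ x, ⟪-((‖x - y‖ ^ 2 + ε ^ 2)⁻¹ • (x - y)), g x⟫ := by
  set b := EuclideanSpace.basisFun (Fin 2) ℝ
  set φ : Fin 2 → Plane → ℝ := fun i x => -(⟪x - y, b i⟫ * (‖x - y‖ ^ 2 + ε ^ 2)⁻¹) with hφ
  have hs : ∀ x : Plane, ‖x - y‖ ^ 2 + ε ^ 2 ≠ 0 := fun x => by positivity
  have hsm : ∀ i, ContDiff ℝ (⊤ : ℕ∞) (φ i) := fun i => by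
    refine ContDiff.neg (ContDiff.mul ((contDiff_id.sub contDiff_const).inner ℝ contDiff_const)
      (ContDiff.inv ?_ hs))
    exact ((contDiff_id.sub contDiff_const).norm_sq ℝ).add contDiff_const
  have hd : ∀ i, Continuous fun x => fderiv ℝ (φ i) x (b i) := fun i =>
    ((hsm i).continuous_fderiv (by simp)).clm_apply continuous_const
  have hi1 : ∀ i, Integrable fun x => f x * fderiv ℝ (φ i) x (b i) := fun i =>
    integrable_mul_of_hasCompactSupport h.1 hf (hd i)
  have hi2 : ∀ i, Integrable fun x => φ i x * ⟪g x, b i⟫ := fun i => by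
    refine (hg.inner_const (b i)).bdd_mul (c := ε⁻¹) (hsm i).continuous.aestronglyMeasurable
      (ae_of_all _ fun x => ?_)
    rw [hφ, norm_neg, norm_mul, norm_inv, Real.norm_of_nonneg (by positivity : 0 ≤ ‖x - y‖ ^ 2 + ε ^ 2),
      mul_comm]
    refine le_trans ?_ (inv_sq_add_sq_mul_le ‖x - y‖ hε)
    gcongr
    simpa using norm_inner_le_norm (𝕜 := ℝ) (x - y) (b i)
  have hibp := fun i => h.integral_mul_fderiv hf (hsm i) (b i)
  have e1 : ∀ x, f x * fderiv ℝ (φ 0) x (b 0) + f x * fderiv ℝ (φ 1) x (b 1)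
      = -(2 * π * (f x * approxDelta ε (x - y))) := fun x => by
    have hb := b.sum_sq_inner_right (x - y)
    rw [Fin.sum_univ_two] at hb
    have h0 := hs x
    simp only [hφ, fderiv_inner_div hε, approxDelta, real_inner_comm _ (x - y)] at hb ⊢
    simp only [OrthonormalBasis.norm_eq_one, real_inner_comm (x - y)] at hb ⊢
    field_simp
    linear_combination (2 * f x) * hb
  have e2 : ∀ x, φ 0 x * ⟪g x, b 0⟫ + φ 1 x * ⟪g x, b 1⟫
      = ⟪-((‖x - y‖ ^ 2 + ε ^ 2)⁻¹ • (x - y)), g x⟫ := fun x => by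
    have hb := b.sum_inner_mul_inner (x - y) (g x)
    rw [Fin.sum_univ_two] at hb
    rw [inner_neg_left, real_inner_smul_left, ← hb]
    simp only [hφ, real_inner_comm _ (g x)]
    ring
  calc 2 * π * ∫ x, f x * approxDelta ε (x - y)
      = -∫ x, (f x * fderiv ℝ (φ 0) x (b 0) + f x * fderiv ℝ (φ 1) x (b 1)) := by
        simp only [e1, integral_neg, integral_const_mul, neg_neg]
    _ = ∫ x, (φ 0 x * ⟪g x, b 0⟫ + φ 1 x * ⟪g x, b 1⟫) := by
        rw [integral_add (hi1 0) (hi1 1), integral_add (hi2 0) (hi2 1), hibp 0, hibp 1]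
        ring
    _ = _ := by simp only [e2]

theorem ae_logPot_sub_le {μ : Measure Plane} [IsProbabilityMeasure μ] (hE : wEnergy μ < ⊤) :
    ∀ᵐ y ∂μ, ∀ᵐ x, logPot μ x - logPot μ y ≤ ‖x - y‖ * (majPot μ x).toReal := by
  filter_upwards [ae_integrable_logKernel hE, Measure.ae_ae_of_ae_prod (ae_ne_of_wEnergy_lt_top hE)]
    with y hy hne
  filter_upwards [ae_majPot_lt_top hE] with x hx
  have hx' := integrable_logKernel_of_majPot_lt_top hx
  have hfin := ae_lt_top (measurable_majKernel_right x) hx.ne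
  have hmi : Integrable (fun z => (majKernel x z).toReal) μ :=
    integrable_toReal_of_lintegral_ne_top (measurable_majKernel_right x).aemeasurable hx.ne
  have hmaj : (majPot μ x).toReal = ∫ z, (majKernel x z).toReal ∂μ :=
    (integral_toReal (measurable_majKernel_right x).aemeasurable hfin).symm
  rw [hmaj, logPot, logPot, ← integral_sub hx' hy, ← integral_const_mul]
  refine integral_mono_ae (hx'.sub hy) (hmi.const_mul _) ?_
  filter_upwards [hne, hfin] with z hyz hz
  have hxz : x ≠ z := by
    rintro rfl
    simp [majKernel] at hz
  have hr : 0 < ‖x - z‖ := norm_pos_iff.2 (sub_ne_zero.2 hxz)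
  have hs : 0 < ‖y - z‖ := norm_pos_iff.2 (sub_ne_zero.2 hyz)
  have h1 : ‖x - z‖⁻¹ ≤ (majKernel x z).toReal := by
    rw [← ENNReal.ofReal_le_iff_le_toReal hz.ne, ENNReal.ofReal_inv_of_pos hr, ofReal_norm]
    exact le_add_self
  have h2 : log (‖y - z‖ / ‖x - z‖) ≤ ‖y - z‖ / ‖x - z‖ - 1 :=
    log_le_sub_one_of_pos (by positivity)
  have h3 : ‖y - z‖ ≤ ‖x - y‖ + ‖x - z‖ := by
    rw [norm_sub_rev x y]
    simpa using norm_add_le (y - x) (x - z)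
  rw [log_div hs.ne' hr.ne'] at h2
  calc logKernel x z - logKernel y z ≤ ‖y - z‖ / ‖x - z‖ - 1 := by
        rw [logKernel_eq_neg_log, logKernel_eq_neg_log]
        linarith
    _ ≤ ‖x - y‖ * ‖x - z‖⁻¹ := by
        rw [sub_le_iff_le_add, ← div_eq_mul_inv, div_add_one hr.ne']
        gcongr
    _ ≤ _ := by gcongr

theorem approxDelta_le (ε : ℝ) {z : Plane} {δ : ℝ} (hδ : 0 < δ) (hz : δ ≤ ‖z‖) :
    approxDelta ε z ≤ ε ^ 2 * (1 + (δ ^ 2)⁻¹) ^ 2 * approxDelta 1 z := by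
  have hz0 : 0 < ‖z‖ := hδ.trans_le hz
  have h1 : 1 ≤ ‖z‖ ^ 2 * (δ ^ 2)⁻¹ := by
    rw [← div_eq_mul_inv, one_le_div (by positivity)]
    gcongr
  unfold approxDelta
  rw [← mul_div_assoc, div_le_div_iff₀ (by positivity) (by positivity)]
  have h2 : ‖z‖ ^ 2 + 1 ^ 2 ≤ (1 + (δ ^ 2)⁻¹) * (‖z‖ ^ 2 + ε ^ 2) := by
    have : 0 ≤ (δ ^ 2)⁻¹ := by positivity
    nlinarith [mul_nonneg this (sq_nonneg ε)]
  calc ε ^ 2 * (π * (‖z‖ ^ 2 + 1 ^ 2) ^ 2)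
      ≤ ε ^ 2 * (π * ((1 + (δ ^ 2)⁻¹) * (‖z‖ ^ 2 + ε ^ 2)) ^ 2) := by gcongr
    _ = _ := by ring

theorem sq_norm_mul_approxDelta_le (ε : ℝ) (z : Plane) : ‖z‖ ^ 2 * approxDelta ε z ≤ 1 := by
  unfold approxDelta
  rw [← mul_div_assoc]
  refine div_le_one_of_le₀ ?_ (by positivity)
  have : ‖z‖ ^ 2 * ε ^ 2 ≤ (‖z‖ ^ 2 + ε ^ 2) ^ 2 := by
    nlinarith [mul_nonneg (sq_nonneg ‖z‖) (sq_nonneg ε), sq_nonneg (‖z‖ ^ 2), sq_nonneg (ε ^ 2)]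
  nlinarith [pi_gt_three, sq_nonneg (‖z‖ ^ 2 + ε ^ 2)]

theorem approxDelta_le_inv {ε : ℝ} (hε : 0 < ε) (z : Plane) : approxDelta ε z ≤ (ε ^ 2)⁻¹ := by
  unfold approxDelta
  rw [← one_div, div_le_div_iff₀ (by positivity) (by positivity)]
  have : (ε ^ 2) ^ 2 ≤ (‖z‖ ^ 2 + ε ^ 2) ^ 2 := by
    gcongr
    nlinarith [sq_nonneg ‖z‖]
  nlinarith [pi_gt_three]

theorem Integrable.mul_approxDelta {f : Plane → ℝ} (hf : Integrable f) {ε : ℝ} (hε : 0 < ε)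
    (y : Plane) : Integrable fun x => f x * approxDelta ε (x - y) := by
  refine hf.mul_bdd (c := (ε ^ 2)⁻¹) ?_ (ae_of_all _ fun x => ?_)
  · exact ((continuous_approxDelta hε).comp (continuous_id.sub continuous_const)).aestronglyMeasurable
  · rw [Real.norm_of_nonneg (approxDelta_nonneg _ _)]
    exact approxDelta_le_inv hε _

/-- A lower bound for limits of the mollifications of a function at a point near which it is
bounded below by a continuous function up to an error controlled by an `L²` function. -/
theorem le_of_tendsto_integral_mul_approxDelta {f v P : Plane → ℝ} {y : Plane} {l : ℝ}
    (hf : Integrable f) (hv : ContinuousAt v y) (hP : IntegrableOn (fun x => P x ^ 2) (ball y 1))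
    (h : ∀ᵐ x, v x - v y - ‖x - y‖ * P x ≤ f x - f y) {ε : ℕ → ℝ} (hε : ∀ n, 0 < ε n)
    (hε0 : Tendsto ε atTop (𝓝 0))
    (hl : Tendsto (fun n => ∫ x, f x * approxDelta (ε n) (x - y)) atTop (𝓝 l)) : f y ≤ l := by
  refine le_of_forall_pos_le_add fun η' hη' => ?_
  obtain ⟨η, hη, rfl⟩ : ∃ η > 0, η' = 3 * η := ⟨η' / 3, by positivity, by ring⟩
  obtain ⟨δ, hδ, hδ1, hvδ, hPδ⟩ : ∃ δ > 0, δ ≤ 1 ∧ (∀ x ∈ ball y δ, |v x - v y| ≤ η) ∧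
      ∫ x in ball y δ, P x ^ 2 ≤ η ^ 2 := by
    have hball : Tendsto (fun δ : ℝ => (volume.restrict (ball y 1)) (ball y δ)) (𝓝[>] 0) (𝓝 0) := by
      have h1 : Continuous fun δ : ℝ => ENNReal.ofReal δ ^ 2 * ENNReal.ofReal π :=
        ENNReal.continuous_mul_const (by simp) |>.comp
          ((ENNReal.continuous_pow 2).comp ENNReal.continuous_ofReal)
      have h2 : Tendsto (fun δ : ℝ => ENNReal.ofReal δ ^ 2 * ENNReal.ofReal π) (𝓝[>] 0) (𝓝 0) := by
        simpa using (h1.tendsto 0).mono_left nhdsWithin_le_nhds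
      refine tendsto_of_tendsto_of_tendsto_of_le_of_le tendsto_const_nhds h2
        (fun _ => zero_le) fun δ => ?_
      rw [← EuclideanSpace.volume_ball_fin_two y δ]
      exact Measure.restrict_apply_le _ _
    have h2 := hP.tendsto_setIntegral_nhds_zero hball
    have h3 : ∀ᶠ δ in 𝓝[>] (0 : ℝ), ∀ x ∈ ball y δ, |v x - v y| ≤ η := by
      obtain ⟨r, hr, hvr⟩ := Metric.continuousAt_iff.1 hv η hη
      filter_upwards [Ioc_mem_nhdsGT hr] with δ hδ x hx
      exact (hvr (lt_of_lt_of_le hx hδ.2)).le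
    have h4 : ∀ᶠ δ in 𝓝[>] (0 : ℝ), δ ∈ Set.Ioc (0 : ℝ) 1 := Ioc_mem_nhdsGT one_pos
    obtain ⟨δ, h5, h6, h7⟩ := ((h2.eventually_le_const (by positivity : 0 < η ^ 2)).and
      (h3.and h4)).exists
    refine ⟨δ, h7.1, h7.2, h6, ?_⟩
    rwa [Measure.restrict_restrict measurableSet_ball,
      Set.inter_eq_left.2 (ball_subset_ball h7.2)] at h5
  set C := (1 + (δ ^ 2)⁻¹) ^ 2 with hC
  set D := ∫ x, (|f x| + |f y|) * approxDelta 1 (x - y)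
  have hρ1 : ∀ {ε : ℝ}, 0 < ε → Integrable fun x => approxDelta ε (x - y) := fun hε =>
    (integrable_approxDelta hε).comp_sub_right y
  have hρ2 : ∀ {ε : ℝ}, 0 < ε → ∫ x, approxDelta ε (x - y) = 1 := fun hε => by
    rw [integral_sub_right_eq_self (fun x => approxDelta _ x), integral_approxDelta hε]
  have hDi : Integrable fun x => (|f x| + |f y|) * approxDelta 1 (x - y) := by
    simp only [add_mul]
    exact (Integrable.mul_approxDelta hf.abs one_pos y).add ((hρ1 one_pos).const_mul _)
  have hPi : Integrable ((ball y δ).indicator fun x => P x ^ 2) :=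
    (hP.mono_set (ball_subset_ball hδ1)).integrable_indicator measurableSet_ball
  have key : ∀ n, f y - 3 * η - ε n ^ 2 * (C * D) ≤ ∫ x, f x * approxDelta (ε n) (x - y) := by
    intro n
    have hi1 : Integrable fun x => (f y - 2 * η) * approxDelta (ε n) (x - y) :=
      (hρ1 (hε n)).const_mul _
    have hi2 : Integrable fun x => (4 * η)⁻¹ * (ball y δ).indicator (fun x => P x ^ 2) x :=
      hPi.const_mul _
    have hi12 : Integrable fun x => (f y - 2 * η) * approxDelta (ε n) (x - y)
        - (4 * η)⁻¹ * (ball y δ).indicator (fun x => P x ^ 2) x := hi1.sub hi2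
    have hlow : Integrable fun x => (f y - 2 * η) * approxDelta (ε n) (x - y)
        - (4 * η)⁻¹ * (ball y δ).indicator (fun x => P x ^ 2) x
        - ε n ^ 2 * C * ((|f x| + |f y|) * approxDelta 1 (x - y)) :=
      hi12.sub (hDi.const_mul _)
    have hval : ∫ x, ((f y - 2 * η) * approxDelta (ε n) (x - y)
        - (4 * η)⁻¹ * (ball y δ).indicator (fun x => P x ^ 2) x
        - ε n ^ 2 * C * ((|f x| + |f y|) * approxDelta 1 (x - y)))
        = (f y - 2 * η) - (4 * η)⁻¹ * (∫ x in ball y δ, P x ^ 2) - ε n ^ 2 * C * D := by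
      rw [integral_sub hi12 (hDi.const_mul _), integral_sub hi1 hi2, integral_const_mul,
        integral_const_mul, integral_const_mul, hρ2 (hε n), integral_indicator measurableSet_ball,
        mul_one]
    have hle : (4 * η)⁻¹ * (∫ x in ball y δ, P x ^ 2) ≤ η := by
      rw [inv_mul_le_iff₀ (by positivity)]
      nlinarith
    calc f y - 3 * η - ε n ^ 2 * (C * D) ≤ _ := by
          rw [← mul_assoc]
          linarith
      _ = _ := hval.symm
      _ ≤ _ := by
        refine integral_mono_ae hlow (Integrable.mul_approxDelta hf (hε n) y) ?_
        filter_upwards [h] with x hx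
        have hρ0 := approxDelta_nonneg (ε n) (x - y)
        have hρ10 := approxDelta_nonneg 1 (x - y)
        have hC0 : 0 ≤ C := by positivity
        have hD0 : 0 ≤ ε n ^ 2 * C * ((|f x| + |f y|) * approxDelta 1 (x - y)) := by positivity
        by_cases hxb : x ∈ ball y δ
        · have h1 := (abs_le.1 (hvδ x hxb)).1
          have h2 := sq_norm_mul_approxDelta_le (ε n) (x - y)
          have h3 : ‖x - y‖ * P x * approxDelta (ε n) (x - y)
              ≤ η * approxDelta (ε n) (x - y) + (4 * η)⁻¹ * P x ^ 2 := by
            have h4 : (‖x - y‖ * approxDelta (ε n) (x - y)) ^ 2 ≤ approxDelta (ε n) (x - y) := by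
              nlinarith
            have h5 : 0 ≤ (4 * η)⁻¹ * (2 * η * (‖x - y‖ * approxDelta (ε n) (x - y)) - P x) ^ 2 := by
              positivity
            have h6 : (4 * η)⁻¹ * (2 * η * (‖x - y‖ * approxDelta (ε n) (x - y)) - P x) ^ 2
                = η * (‖x - y‖ * approxDelta (ε n) (x - y)) ^ 2
                  - ‖x - y‖ * P x * approxDelta (ε n) (x - y) + (4 * η)⁻¹ * P x ^ 2 := by
              field_simp
              ring
            nlinarith
          rw [Set.indicator_of_mem hxb]
          nlinarith
        · have h1 : δ ≤ ‖x - y‖ := by simpa [dist_eq_norm] using hxb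
          have h2 := approxDelta_le (ε n) hδ h1
          rw [Set.indicator_of_notMem hxb]
          have h3 : f y - f x ≤ |f x| + |f y| := by
            linarith [le_abs_self (f y), neg_abs_le (f x)]
          have h4 : (f y - f x) * approxDelta (ε n) (x - y)
              ≤ ε n ^ 2 * C * ((|f x| + |f y|) * approxDelta 1 (x - y)) := by
            calc (f y - f x) * approxDelta (ε n) (x - y)
                ≤ (|f x| + |f y|) * (ε n ^ 2 * C * approxDelta 1 (x - y)) := by gcongr
              _ = _ := by ring
          nlinarith
  have hlim : Tendsto (fun n => f y - 3 * η - ε n ^ 2 * (C * D)) atTop (𝓝 (f y - 3 * η)) := by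
    simpa using ((hε0.pow 2).mul_const (C * D)).const_sub (f y - 3 * η)
  have := le_of_tendsto_of_tendsto' hlim hl key
  linarith

theorem tendsto_integral_regularized_logGrad {g : Plane → Plane} (hg : AEStronglyMeasurable g volume)
    {y : Plane} (hi : Integrable fun x => ‖x - y‖⁻¹ * ‖g x‖) {ε : ℕ → ℝ}
    (hε0 : Tendsto ε atTop (𝓝 0)) :
    Tendsto (fun n => ∫ x, ⟪-((‖x - y‖ ^ 2 + ε n ^ 2)⁻¹ • (x - y)), g x⟫) atTop
      (𝓝 (∫ x, ⟪logGrad x y, g x⟫)) := by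
  have hne : ∀ᵐ x ∂(volume : Measure Plane), x ≠ y := by simp [ae_iff]
  refine tendsto_integral_of_dominated_convergence (fun x => ‖x - y‖⁻¹ * ‖g x‖) (fun n => ?_) hi
    (fun n => ?_) ?_
  · exact (Measurable.aestronglyMeasurable (by fun_prop)).inner hg
  · filter_upwards [hne] with x hx
    have hr : 0 < ‖x - y‖ := norm_pos_iff.2 (sub_ne_zero.2 hx)
    refine (norm_inner_le_norm _ _).trans ?_
    gcongr
    rw [norm_neg, norm_smul, norm_inv,
      Real.norm_of_nonneg (by positivity : 0 ≤ ‖x - y‖ ^ 2 + ε n ^ 2),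
      inv_mul_le_iff₀ (by positivity), ← div_eq_mul_inv, le_div_iff₀ hr]
    nlinarith [sq_nonneg (ε n)]
  · filter_upwards [hne] with x hx
    have hr : 0 < ‖x - y‖ := norm_pos_iff.2 (sub_ne_zero.2 hx)
    have h1 : Tendsto (fun n => (‖x - y‖ ^ 2 + ε n ^ 2)⁻¹) atTop (𝓝 (‖x - y‖ ^ 2)⁻¹) := by
      have := ((hε0.pow 2).const_add (‖x - y‖ ^ 2)).inv₀ (by positivity)
      simpa using this
    exact ((h1.smul_const (x - y)).neg).inner tendsto_const_nhds

theorem integrableOn_sq_toReal_majPot {μ : Measure Plane} [IsProbabilityMeasure μ]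
    (hE : wEnergy μ < ⊤) (y : Plane) :
    IntegrableOn (fun x => (majPot μ x).toReal ^ 2) (ball y 1) := by
  refine ⟨((measurable_majPot μ).ennreal_toReal.pow_const 2).aestronglyMeasurable, ?_⟩
  refine lt_of_le_of_lt ?_ (lintegral_ball_majPot_sq_lt_top hE (‖y‖ + 1))
  refine (lintegral_mono_set (ball_subset_ball' (by simp [add_comm]))).trans
    (lintegral_mono fun x => ?_)
  rw [enorm_pow]
  gcongr
  rw [Real.enorm_of_nonneg ENNReal.toReal_nonneg]
  exact ENNReal.ofReal_toReal_le

theorem integrable_sub_logPot_of_hasCompactSupport {μ : Measure Plane} [IsProbabilityMeasure μ]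
    (hE : wEnergy μ < ⊤) {v : Plane → ℝ} (hv : Continuous v)
    (hc : HasCompactSupport fun x => v x - logPot μ x) :
    Integrable (fun x => v x - logPot μ x) μ := by
  refine (integrableOn_iff_integrable_of_support_subset (subset_tsupport _)).1 ?_
  exact (hv.continuousOn.integrableOn_compact hc.isCompact).sub (integrable_logPot hE).integrableOn

/-- Integration by parts against the Laplacian of the potential, as an inequality. -/
theorem two_pi_mul_integral_le {μ : Measure Plane} [IsProbabilityMeasure μ] (hE : wEnergy μ < ⊤)
    {v : Plane → ℝ} {g : Plane → Plane} (hv : Continuous v)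
    (hw : HasWeakGradient (fun x => v x - logPot μ x) g)
    (hc : HasCompactSupport fun x => v x - logPot μ x) (hg2 : LocSqInt g) :
    2 * π * ∫ y, (v y - logPot μ y) ∂μ ≤ ∫ x, ⟪gradPot μ x, g x⟫ := by
  set f : Plane → ℝ := fun x => v x - logPot μ x with hf
  have hgm : AEStronglyMeasurable g volume := hw.2.1.aestronglyMeasurable
  have hg0 := hw.ae_eq_zero
  have hgi : Integrable g := by
    refine (hw.2.1.integrableOn_isCompact hc.isCompact).integrable_of_ae_notMem_eq_zero hg0
  have hfi : Integrable f := by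
    simpa using integrable_mul_of_hasCompactSupport hw.1 hc (continuous_const (y := (1 : ℝ)))
  have hfμ : Integrable f μ := integrable_sub_logPot_of_hasCompactSupport hE hv hc
  obtain ⟨R, hR⟩ := hc.isCompact.isBounded.subset_ball 0
  have hsq : ∫⁻ x in ball 0 R, ‖g x‖ₑ ^ 2 < ⊤ :=
    (lintegral_mono_set ball_subset_closedBall).trans_lt (hg2 _ (isCompact_closedBall 0 R))
  have hg0' : ∀ᵐ x, x ∉ ball (0 : Plane) R → ‖g x‖ₑ = 0 := by
    filter_upwards [hg0] with x hx hxR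
    simpa using hx fun h => hxR (hR h)
  have hgp : AEStronglyMeasurable (fun p : Plane × Plane => g p.1) (volume.prod μ) :=
    hgm.comp_fst
  have hi1 : Integrable (fun p : Plane × Plane => ‖p.1 - p.2‖⁻¹ * ‖g p.1‖) (volume.prod μ) := by
    refine integrable_prod_of_enorm_le_mul_majKernel hE
      ((Measurable.aestronglyMeasurable (by fun_prop)).mul hgp.norm) hsq hg0' fun x y => ?_
    rw [enorm_mul, enorm_norm, mul_comm, ← norm_logGrad, enorm_norm]
    gcongr
    exact enorm_logGrad_le x y
  have hi2 : Integrable (fun p : Plane × Plane => ⟪logGrad p.1 p.2, g p.1⟫) (volume.prod μ) := by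
    refine hi1.mono (measurable_logGrad.aestronglyMeasurable.inner hgp) (ae_of_all _ fun p => ?_)
    refine (norm_inner_le_norm _ _).trans (le_of_eq ?_)
    rw [norm_logGrad, Real.norm_of_nonneg (by positivity)]
  calc 2 * π * ∫ y, f y ∂μ = ∫ y, 2 * π * f y ∂μ := (integral_const_mul _ _).symm
    _ ≤ ∫ y, ∫ x, ⟪logGrad x y, g x⟫ ∂volume ∂μ := by
        refine integral_mono_ae (hfμ.const_mul _) hi2.integral_prod_right ?_
        filter_upwards [hi1.prod_left_ae, ae_logPot_sub_le hE] with y hy hle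
        set ε : ℕ → ℝ := fun n => 1 / ((n : ℝ) + 1)
        have hε : ∀ n, 0 < ε n := fun n => Nat.one_div_pos_of_nat
        have hε0 : Tendsto ε atTop (𝓝 0) := tendsto_one_div_add_atTop_nhds_zero_nat
        have hlim := tendsto_integral_regularized_logGrad hgm hy hε0
        simp only [← fun n => hw.integral_mul_approxDelta hc hgi (hε n) y] at hlim
        have hlim' := hlim.const_mul (2 * π)⁻¹
        simp only [inv_mul_cancel_left₀ (by positivity : 2 * π ≠ 0)] at hlim'
        have := le_of_tendsto_integral_mul_approxDelta hfi hv.continuousAt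
          (integrableOn_sq_toReal_majPot hE y) ?_ hε hε0 hlim'
        · rwa [← div_eq_inv_mul, le_div_iff₀' (by positivity)] at this
        · filter_upwards [hle] with x hx
          simp only [hf]
          linarith
    _ = ∫ x, ∫ y, ⟪logGrad x y, g x⟫ ∂μ :=
        (integral_integral_swap (f := fun x y => ⟪logGrad x y, g x⟫) hi2).symm
    _ = ∫ x, ⟪gradPot μ x, g x⟫ := by
        refine integral_congr_ae ?_
        filter_upwards [ae_majPot_lt_top hE] with x hx
        exact integral_inner_logGrad_left hx (g x)

theorem wKernel_comm (x y : Plane) : wKernel x y = wKernel y x := by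
  simp only [wKernel, logKernel_comm x y, eq_comm (a := x), add_comm (‖x‖ ^ 2)]

/-- The mutual weighted energy of two measures. -/
noncomputable def mutualEnergy (μ ν : Measure Plane) : ℝ≥0∞ :=
  ∫⁻ p : Plane × Plane, wKernel p.1 p.2 ∂(μ.prod ν)

theorem mutualEnergy_comm (μ ν : Measure Plane) [SFinite μ] [SFinite ν] :
    mutualEnergy μ ν = mutualEnergy ν μ := by
  unfold mutualEnergy
  rw [← Measure.prod_swap, lintegral_map (measurable_wKernel) measurable_swap]
  simp only [Prod.fst_swap, Prod.snd_swap, wKernel_comm]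

theorem mutualEnergy_add_left (μ μ' ν : Measure Plane) [SFinite μ] [SFinite μ'] [SFinite ν] :
    mutualEnergy (μ + μ') ν = mutualEnergy μ ν + mutualEnergy μ' ν := by
  unfold mutualEnergy
  rw [Measure.add_prod, lintegral_add_measure]

theorem mutualEnergy_smul_left (c : ℝ≥0∞) (μ ν : Measure Plane) [SFinite μ] [SFinite ν] :
    mutualEnergy (c • μ) ν = c * mutualEnergy μ ν := by
  unfold mutualEnergy
  rw [Measure.prod_smul_left, lintegral_smul_measure, smul_eq_mul]

theorem wEnergy_smul_add_smul (c d : ℝ≥0∞) (μ ν : Measure Plane) [SFinite μ] [SFinite ν] :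
    wEnergy (c • μ + d • ν) = c ^ 2 * mutualEnergy μ μ + 2 * c * d * mutualEnergy μ ν
      + d ^ 2 * mutualEnergy ν ν := by
  change mutualEnergy _ _ = _
  rw [mutualEnergy_add_left, mutualEnergy_smul_left, mutualEnergy_smul_left,
    mutualEnergy_comm μ, mutualEnergy_comm ν, mutualEnergy_add_left, mutualEnergy_add_left,
    mutualEnergy_smul_left, mutualEnergy_smul_left, mutualEnergy_smul_left, mutualEnergy_smul_left,
    mutualEnergy_comm ν μ]
  ring

/-- Stationarity of a minimizer with respect to exchange of mass between `Γ` and its complement. -/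
theorem IsMinimizer.setIntegral_effPot_eq {Γ : Set Plane} {a : ℝ} {μ : Measure Plane}
    (h : IsMinimizer Γ a μ) (hΓ : MeasurableSet Γ) (ham : a < μ.real Γ) (hm1 : μ.real Γ < 1)
    (ha : 0 < a) :
    (1 - μ.real Γ) * ∫ x in Γ, effPot μ x ∂μ = μ.real Γ * ∫ x in Γᶜ, effPot μ x ∂μ := by
  have : IsProbabilityMeasure μ := h.1.1
  have hE := h.2.1
  set m := μ.real Γ with hm
  have hmc : μ.real Γᶜ = 1 - m := by rw [measureReal_compl hΓ, probReal_univ]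
  set α := μ.restrict Γ
  set β := μ.restrict Γᶜ
  have hαβ : α + β = μ := Measure.restrict_add_restrict_compl hΓ
  have hμ := wEnergy_smul_add_smul 1 1 α β
  simp only [one_smul, hαβ, one_pow, one_mul, mul_one] at hμ
  have hfin := hE
  rw [hμ, ENNReal.add_lt_top, ENNReal.add_lt_top] at hfin
  obtain ⟨⟨hp, hq⟩, hr⟩ := hfin
  replace hq : mutualEnergy α β < ⊤ := lt_of_le_of_lt (by rw [two_mul]; exact le_self_add) hq
  set p := (mutualEnergy α α).toReal
  set q := (mutualEnergy α β).toReal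
  set r := (mutualEnergy β β).toReal
  have hQ : ∀ {c d : ℝ}, 0 ≤ c → 0 ≤ d →
      wEnergy (ENNReal.ofReal c • α + ENNReal.ofReal d • β)
        = ENNReal.ofReal (c ^ 2 * p + 2 * c * d * q + d ^ 2 * r) := fun {c d} hc hd => by
    rw [wEnergy_smul_add_smul, ← ENNReal.ofReal_toReal hp.ne, ← ENNReal.ofReal_toReal hq.ne,
      ← ENNReal.ofReal_toReal hr.ne, ENNReal.ofReal_add (by positivity) (by positivity),
      ENNReal.ofReal_add (by positivity) (by positivity), ENNReal.ofReal_mul (by positivity),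
      ENNReal.ofReal_mul (by positivity), ENNReal.ofReal_mul (by positivity),
      ENNReal.ofReal_mul (by positivity), ENNReal.ofReal_mul (by positivity),
      ENNReal.ofReal_pow hc, ENNReal.ofReal_pow hd]
    simp [p, q, r]
  have hvar : ∀ t : ℝ, 0 ≤ 1 + t * (1 - m) → 0 ≤ 1 - t * m → a ≤ m * (1 + t * (1 - m)) →
      p + 2 * q + r ≤ (1 + t * (1 - m)) ^ 2 * p
        + 2 * (1 + t * (1 - m)) * (1 - t * m) * q + (1 - t * m) ^ 2 * r := by
    intro t hc hd hat
    have hαu : α Set.univ = ENNReal.ofReal m := by simp [α, hm]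
    have hβu : β Set.univ = ENNReal.ofReal (1 - m) := by simp [β, ← hmc]
    have hα : α Γ = ENNReal.ofReal m := by simp [α, hm]
    have hmem : ENNReal.ofReal (1 + t * (1 - m)) • α + ENNReal.ofReal (1 - t * m) • β ∈ Ma Γ a := by
      refine ⟨⟨?_⟩, ?_⟩
      · rw [Measure.add_apply, Measure.smul_apply, Measure.smul_apply, hαu, hβu, smul_eq_mul,
          smul_eq_mul, ← ENNReal.ofReal_mul hc, ← ENNReal.ofReal_mul hd, ← ENNReal.ofReal_add
          (by nlinarith) (by nlinarith), ← ENNReal.ofReal_one]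
        congr 1
        ring
      · rw [Measure.add_apply, Measure.smul_apply, hα, smul_eq_mul, ← ENNReal.ofReal_mul hc]
        refine le_trans (ENNReal.ofReal_le_ofReal ?_) le_self_add
        linarith
    have h1 := h.2.2 _ hmem
    rw [hQ hc hd] at h1
    have h2 := hQ zero_le_one zero_le_one
    simp only [ENNReal.ofReal_one, one_smul, hαβ] at h2
    rw [h2, ENNReal.ofReal_le_ofReal_iff (by positivity)] at h1
    linarith
  have hstat : (1 - m) * (p + q) = m * (q + r) := by
    have hloc : IsLocalMin (fun t : ℝ => (1 + t * (1 - m)) ^ 2 * p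
        + 2 * (1 + t * (1 - m)) * (1 - t * m) * q + (1 - t * m) ^ 2 * r) 0 := by
      have e1 : ∀ᶠ t : ℝ in 𝓝 0, 0 < 1 + t * (1 - m) :=
        continuousAt_const.eventually_lt (by fun_prop) (by simp)
      have e2 : ∀ᶠ t : ℝ in 𝓝 0, 0 < 1 - t * m :=
        continuousAt_const.eventually_lt (by fun_prop) (by simp)
      have e3 : ∀ᶠ t : ℝ in 𝓝 0, a < m * (1 + t * (1 - m)) :=
        continuousAt_const.eventually_lt (by fun_prop) (by simpa using ham)
      filter_upwards [e1, e2, e3] with t h1 h2 h3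
      have := hvar t h1.le h2.le h3.le
      linarith
    have h1 : HasDerivAt (fun t : ℝ => 1 + t * (1 - m)) (1 - m) 0 := by
      simpa using ((hasDerivAt_id (0 : ℝ)).mul_const (1 - m)).const_add 1
    have h2 : HasDerivAt (fun t : ℝ => 1 - t * m) (-m) 0 := by
      simpa using ((hasDerivAt_id (0 : ℝ)).mul_const m).const_sub 1
    have h3 := (((h1.pow 2).mul_const p).add (((h1.const_mul 2).mul h2).mul_const q)).add
      ((h2.pow 2).mul_const r)
    have h4 := hloc.hasDerivAt_eq_zero h3
    simp at h4
    linarith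
  have hX := toReal_lintegral_restrict_prod_wKernel hE Γ
  have hY := toReal_lintegral_restrict_prod_wKernel hE Γᶜ
  have hX' : mutualEnergy α μ = mutualEnergy α α + mutualEnergy α β := by
    rw [mutualEnergy_comm, ← hαβ, mutualEnergy_add_left, mutualEnergy_comm β]
  have hY' : mutualEnergy β μ = mutualEnergy α β + mutualEnergy β β := by
    rw [mutualEnergy_comm, ← hαβ, mutualEnergy_add_left]
  change (mutualEnergy α μ).toReal = _ at hX
  change (mutualEnergy β μ).toReal = _ at hY
  rw [hX', ENNReal.toReal_add hp.ne hq.ne] at hX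
  rw [hY', ENNReal.toReal_add hq.ne hr.ne] at hY
  change p + q = _ at hX
  change q + r = _ at hY
  rw [hX, hY, hmc] at hstat
  linarith

theorem obstacle_sub_logPot (Γ : Set Plane) (a : ℝ) (μ : Measure Plane) (x : Plane) :
    obstacle Γ a μ x - logPot μ x = Γ.indicator (fun _ => AΓ Γ a μ / 2) x
      + Γᶜ.indicator (fun _ => A0 Γ a μ / 2) x - effPot μ x / 2 := by
  by_cases hx : x ∈ Γ <;> simp [obstacle, effPot, hx] <;> ring

theorem integrable_obstacle_sub_logPot {Γ : Set Plane} (hΓ : MeasurableSet Γ) (a : ℝ)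
    {μ : Measure Plane} [IsProbabilityMeasure μ] (hE : wEnergy μ < ⊤) :
    Integrable (fun x => obstacle Γ a μ x - logPot μ x) μ := by
  simp only [obstacle_sub_logPot]
  exact (((integrable_const _).indicator hΓ).add ((integrable_const _).indicator hΓ.compl)).sub
    ((integrable_effPot hE).div_const 2)

theorem IsMinimizer.integral_obstacle_sub_logPot_nonneg {Γ : Set Plane} {a : ℝ} {μ : Measure Plane}
    (h : IsMinimizer Γ a μ) (hΓ : MeasurableSet Γ) (ha : a ∈ Set.Ioo (0 : ℝ) 1) :
    0 ≤ ∫ x, (obstacle Γ a μ x - logPot μ x) ∂μ := by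
  have : IsProbabilityMeasure μ := h.1.1
  have hE := h.2.1
  obtain ⟨ha0, ha1⟩ := ha
  have ham : a ≤ μ.real Γ := (ENNReal.ofReal_le_iff_le_toReal (by simp)).1 h.1.2
  have hmc : μ.real Γᶜ = 1 - μ.real Γ := by rw [measureReal_compl hΓ, probReal_univ]
  have hi1 : Integrable (Γ.indicator fun _ => AΓ Γ a μ / 2) μ := (integrable_const _).indicator hΓ
  have hi2 : Integrable (Γᶜ.indicator fun _ => A0 Γ a μ / 2) μ :=
    (integrable_const _).indicator hΓ.compl
  have hi12 : Integrable (fun x => Γ.indicator (fun _ => AΓ Γ a μ / 2) x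
      + Γᶜ.indicator (fun _ => A0 Γ a μ / 2) x) μ := hi1.add hi2
  have htot := integral_add_compl hΓ (integrable_effPot hE)
  have hval : ∫ x, (obstacle Γ a μ x - logPot μ x) ∂μ
      = (μ.real Γ * (a⁻¹ * ∫ x in Γ, effPot μ x ∂μ)
        + (1 - μ.real Γ) * ((1 - a)⁻¹ * ∫ x in Γᶜ, effPot μ x ∂μ)
        - ∫ x, effPot μ x ∂μ) / 2 := by
    simp only [obstacle_sub_logPot]
    rw [integral_sub hi12 ((integrable_effPot hE).div_const 2), integral_add hi1 hi2,
      integral_indicator_const _ hΓ, integral_indicator_const _ hΓ.compl, integral_div, hmc,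
      smul_eq_mul, smul_eq_mul]
    simp only [AΓ, A0, effPot]
    ring
  have hC := integral_effPot_nonneg hE
  rw [hval]
  have ha1' : 0 < 1 - a := by linarith
  rcases ham.eq_or_lt with ham | ham
  · rw [← ham, ← htot, mul_inv_cancel_left₀ ha0.ne', mul_inv_cancel_left₀ ha1'.ne']
    simp
  have hX : ∫ x in Γ, effPot μ x ∂μ = μ.real Γ * ∫ x, effPot μ x ∂μ
      ∧ ∫ x in Γᶜ, effPot μ x ∂μ = (1 - μ.real Γ) * ∫ x, effPot μ x ∂μ := by
    rcases (measureReal_le_one (μ := μ) (s := Γ)).eq_or_lt with hm1 | hm1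
    · have h0 : μ Γᶜ = 0 := by
        rw [hm1, sub_self] at hmc
        exact (measureReal_eq_zero_iff).1 hmc
      have h1 : ∫ x in Γᶜ, effPot μ x ∂μ = 0 := setIntegral_measure_zero _ h0
      rw [h1, add_zero] at htot
      simp [hm1, h1, htot]
    · have := h.setIntegral_effPot_eq hΓ ham hm1 ha0
      rw [← htot]
      constructor <;> linarith
  rw [hX.1, hX.2]
  have : 0 ≤ (μ.real Γ - a) ^ 2 / (a * (1 - a)) * ∫ x, effPot μ x ∂μ := by positivity
  have e : μ.real Γ * (a⁻¹ * (μ.real Γ * ∫ x, effPot μ x ∂μ))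
      + (1 - μ.real Γ) * ((1 - a)⁻¹ * ((1 - μ.real Γ) * ∫ x, effPot μ x ∂μ))
      - ∫ x, effPot μ x ∂μ = (μ.real Γ - a) ^ 2 / (a * (1 - a)) * ∫ x, effPot μ x ∂μ := by
    field_simp
    ring
  rw [e]
  linarith

/-- `U^{μ_a} ∈ H¹_loc(ℝ²)` (it has a weak gradient `W`, and both
`U^{μ_a}` and `W` are locally square integrable), and for every continuous
`v ∈ H¹_loc(ℝ²)` (with weak gradient `Wv`) such that `v - U^{μ_a}` has compact
support and `v ≥ ψ` everywhere, one has `∫ ∇U^{μ_a} · ∇(v - U^{μ_a}) ≥ 0`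
(the integrand vanishes a.e. outside a compact set, so the integral is well
defined). -/
theorem statement14 (γ : ℝ → Plane) (Γ : Set Plane) (hΓ : RegularCurve γ Γ)
    (a : ℝ) (ha : a ∈ Set.Ioo (0:ℝ) 1)
    (μa : Measure Plane) (hmin : IsMinimizer Γ a μa) :
    ∃ W : Plane → Plane,
      HasWeakGradient (logPot μa) W ∧ LocSqInt (logPot μa) ∧ LocSqInt W ∧
      ∀ (v : Plane → ℝ) (Wv : Plane → Plane),
        Continuous v → HasWeakGradient v Wv → LocSqInt v → LocSqInt Wv →
        HasCompactSupport (fun x => v x - logPot μa x) →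
        (∀ x : Plane, obstacle Γ a μa x ≤ v x) →
        0 ≤ ∫ x, ⟪W x, Wv x - W x⟫ ∂volume := by
  have : IsProbabilityMeasure μa := hmin.1.1
  have hE := hmin.2.1
  have hW := hasWeakGradient_logPot hE
  have hW2 : LocSqInt (gradPot μa) := locSqInt_of_enorm_le_majPot hE (enorm_gradPot_le μa)
  refine ⟨gradPot μa, hW, locSqInt_of_enorm_le_majPot hE (enorm_logPot_le μa), hW2,
    fun v Wv hv hWv _ hWv2 hc hobs => ?_⟩
  refine le_trans ?_ (two_pi_mul_integral_le hE hv (hWv.sub hW) hc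
    (hWv2.sub hW2 hWv.2.1.aestronglyMeasurable))
  have hΓm : MeasurableSet Γ := hΓ.closed.measurableSet
  refine mul_nonneg (by positivity)
    ((hmin.integral_obstacle_sub_logPot_nonneg hΓm ha).trans ?_)
  exact integral_mono (integrable_obstacle_sub_logPot hΓm a hE)
    (integrable_sub_logPot_of_hasCompactSupport hE hv hc) fun x => sub_le_sub_right (hobs x) _
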